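/- H is a nontrivial cyclic group (equivalently r₂(H) = 1) if and only if n has one of the following forms, where p denotes a prime ≡ 1 (mod 4) and q, q₁, q₂ distinct primes ≡ 3 (mod 4): (1) n = p with either (2/p) = −1, or (2/p) = 1 and (2/p)₄ ≠ (p/2)₄; (2) n = q₁q₂ with (2/q₁) = −1 or (2/q₂) = −1; (3) n = pq with (2/p) = −1. -/

import Mathlib

/-- `ε` is the fundamental unit of the real quadratic field `ℚ(√l)` (viewed inside `ℝ`):
it lies in `ℚ(√l)`, it is a unit of the ring of integers (both `ε` and `ε⁻¹` are
algebraic integers), `ε > 1`, and it is the smallest such unit. -/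
def IsFundamentalUnit (l : ℕ) (ε : ℝ) : Prop :=
  1 < ε ∧ ε ∈ IntermediateField.adjoin ℚ ({Real.sqrt (l : ℝ)} : Set ℝ) ∧
    IsIntegral ℤ ε ∧ IsIntegral ℤ ε⁻¹ ∧
    ∀ x : ℝ, 1 < x → x ∈ IntermediateField.adjoin ℚ ({Real.sqrt (l : ℝ)} : Set ℝ) →
      IsIntegral ℤ x → IsIntegral ℤ x⁻¹ → ε ≤ x

/-- The Legendre symbol `(a/p)`, via Euler's criterion (so that no `Fact p.Prime`
instance is needed): for an odd prime `p` it is `1` if `a` is a nonzero square mod `p`,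
`0` if `p ∣ a`, and `-1` otherwise. -/
def legSym (p : ℕ) (a : ℤ) : ℤ :=
  if (a : ZMod p) ^ ((p - 1) / 2) = 1 then 1 else if (a : ZMod p) = 0 then 0 else -1

/-- The rational fourth power residue symbol `(a/p)₄ ∈ {±1}`, meaningful when
`(a/p) = 1`; it is determined by `(a/p)₄ ≡ a ^ ((p-1)/4) (mod p)`. -/
def quartSym (p : ℕ) (a : ℤ) : ℤ :=
  if (a : ZMod p) ^ ((p - 1) / 4) = 1 then 1 else -1

/-- The cardinality of the 2-torsion subgroup of the class group of `K`.
For a number field `K` this equals `2 ^ r₂(H)`, where `r₂(H)` is the rank of the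
2-class group `H` of `K` (i.e. `dim_{𝔽₂} Cl(K)/Cl(K)²`); in particular
`r₂(H) = r` iff this cardinality is `2 ^ r`. -/
noncomputable def twoTorsCard (K : IntermediateField ℚ ℝ) : ℕ :=
  Nat.card {x : ClassGroup (NumberField.RingOfIntegers K) // x ^ 2 = 1}

section TwoTorsion

open scoped nonZeroDivisors

/-- The subgroup of squares of a commutative group. -/
abbrev squares (G : Type*) [CommGroup G] : Subgroup G := (powMonoidHom 2 : G →* G).range

lemma mem_squares {G : Type*} [CommGroup G] {x : G} : x ∈ squares G ↔ ∃ y, y ^ 2 = x := Iff.rfl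

lemma sq_mem_squares {G : Type*} [CommGroup G] (x : G) : x ^ 2 ∈ squares G := ⟨x, rfl⟩

lemma map_squares_le {G H : Type*} [CommGroup G] [CommGroup H] (f : G →* H) :
    (squares G).map f ≤ squares H := by
  rintro _ ⟨_, ⟨y, rfl⟩, rfl⟩
  exact ⟨f y, by simp⟩

section ClassGroup

variable (O L : Type*) [CommRing O] [IsDedekindDomain O] [Field L] [Algebra O L]
  [IsFractionRing O L]

/-- The elements of `Lˣ` that generate the square of a fractional ideal. -/
noncomputable abbrev idealSquares : Subgroup Lˣ :=
  (squares (FractionalIdeal O⁰ L)ˣ).comap (toPrincipalIdeal O L)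

/-- The units of `O`, as a subgroup of `Lˣ`. -/
abbrev unitsSubgroup : Subgroup Lˣ := (Units.map (algebraMap O L : O →* L)).range

omit [IsDedekindDomain O] in
lemma ker_toPrincipalIdeal : (toPrincipalIdeal O L).ker = unitsSubgroup O L := by
  ext x
  rw [MonoidHom.mem_ker, toPrincipalIdeal_eq_iff, MonoidHom.mem_range]
  constructor
  · intro h
    have h1 : (x : L) ∈ FractionalIdeal.spanSingleton O⁰ (x : L) :=
      FractionalIdeal.mem_spanSingleton_self _ _
    have h2 : (1 : L) ∈ FractionalIdeal.spanSingleton O⁰ (x : L) := by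
      rw [h]; exact FractionalIdeal.one_mem_one _
    rw [h, Units.val_one, FractionalIdeal.mem_one_iff] at h1
    rw [FractionalIdeal.mem_spanSingleton] at h2
    obtain ⟨a, ha⟩ := h1
    obtain ⟨b, hb⟩ := h2
    have hab : a * b = 1 := by
      apply IsFractionRing.injective O L
      rw [map_mul, ha, map_one, mul_comm, ← Algebra.smul_def, hb]
    exact ⟨⟨a, b, hab, by rw [mul_comm, hab]⟩, Units.ext ha⟩
  · rintro ⟨u, rfl⟩
    rw [Units.val_one, ← FractionalIdeal.spanSingleton_one]
    apply le_antisymm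
    · rw [FractionalIdeal.spanSingleton_le_iff_mem, FractionalIdeal.mem_spanSingleton]
      exact ⟨u, by simp [Algebra.smul_def]⟩
    · rw [FractionalIdeal.spanSingleton_le_iff_mem, FractionalIdeal.mem_spanSingleton]
      refine ⟨(u⁻¹ : Oˣ), ?_⟩
      rw [Algebra.smul_def, Units.coe_map, MonoidHom.coe_coe, ← map_mul]
      simp

lemma injective_sq_fractionalIdeal :
    Function.Injective (powMonoidHom 2 : (FractionalIdeal O⁰ L)ˣ →* (FractionalIdeal O⁰ L)ˣ) := by
  rw [injective_iff_map_eq_one]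
  intro I h
  have h' : (I : FractionalIdeal O⁰ L) * I = 1 := by
    simpa [sq] using congrArg Units.val h
  have hle : (I : FractionalIdeal O⁰ L) ≤ 1 := by
    intro x hx
    have hxx := FractionalIdeal.mul_mem_mul hx hx
    rw [h', FractionalIdeal.mem_one_iff] at hxx
    obtain ⟨a, ha⟩ := hxx
    have hint : IsIntegral O x := by
      refine IsIntegral.of_pow (n := 2) two_pos ?_
      rw [sq, ← ha]
      exact isIntegral_algebraMap
    rw [FractionalIdeal.mem_one_iff]
    exact IsIntegrallyClosed.isIntegral_iff.mp hint
  refine Units.ext (le_antisymm hle ?_)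
  calc (1 : FractionalIdeal O⁰ L) = I * I := h'.symm
    _ ≤ I * 1 := by gcongr
    _ = I := mul_one _

lemma natCard_classGroup_sq_eq_one :
    Nat.card {x : ClassGroup O // x ^ 2 = 1} =
      (squares Lˣ ⊔ unitsSubgroup O L).relIndex (idealSquares O L) := by
  set φ := toPrincipalIdeal O L
  set sq := (powMonoidHom 2 : (FractionalIdeal O⁰ L)ˣ →* (FractionalIdeal O⁰ L)ˣ)
  have hinj : Function.Injective sq := injective_sq_fractionalIdeal O L
  have hker : φ.ker = unitsSubgroup O L := ker_toPrincipalIdeal O L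
  have hcard : Nat.card {x : ClassGroup O // x ^ 2 = 1} =
      φ.range.relIndex (φ.range.comap sq) := by
    have e := ClassGroup.equiv (R := O) L
    have h1 : φ.range.relIndex (φ.range.comap sq) =
        Nat.card ((φ.range.comap sq).map (QuotientGroup.mk' φ.range)) := by
      rw [← Subgroup.relIndex_ker, QuotientGroup.ker_mk']
    rw [h1]
    refine Nat.card_congr (e.toEquiv.subtypeEquiv fun x => ?_)
    obtain ⟨I, hI⟩ := QuotientGroup.mk'_surjective φ.range (e x)
    change x ^ 2 = 1 ↔ e x ∈ _
    rw [← e.injective.eq_iff, map_pow, map_one, ← hI, ← map_pow, ← MonoidHom.mem_ker,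
      QuotientGroup.ker_mk', Subgroup.mem_map]
    constructor
    · exact fun h => ⟨I, h, rfl⟩
    · rintro ⟨J, hJ, hJI⟩
      rw [QuotientGroup.mk'_eq_mk'] at hJI
      obtain ⟨z, hz, rfl⟩ := hJI
      rw [mul_pow]
      exact mul_mem hJ (pow_mem hz 2)
  have hmapJ : (φ.range.comap sq).map sq = (idealSquares O L).map φ := by
    rw [Subgroup.map_comap_eq, Subgroup.map_comap_eq, inf_comm]
  have hmapP : φ.range.map sq = (squares Lˣ).map φ := by
    ext x
    simp only [Subgroup.mem_map, MonoidHom.mem_range]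
    constructor
    · rintro ⟨_, ⟨y, rfl⟩, rfl⟩
      exact ⟨y ^ 2, ⟨y, rfl⟩, map_pow φ y 2⟩
    · rintro ⟨_, ⟨y, rfl⟩, rfl⟩
      exact ⟨φ y, ⟨y, rfl⟩, (map_pow φ y 2).symm⟩
  rw [hcard, ← Subgroup.relIndex_map_map_of_injective _ _ hinj, hmapJ, hmapP,
    Subgroup.relIndex_map_map, hker]
  congr 1
  rw [sup_eq_left, ← hker]
  intro x hx
  rw [Subgroup.mem_comap, MonoidHom.mem_ker.mp hx]
  exact one_mem _

lemma relIndex_squares_unitsSubgroup :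
    (squares Lˣ).relIndex (unitsSubgroup O L) = (squares Oˣ).index := by
  rw [← Subgroup.index_comap]
  congr 1
  ext u
  simp only [Subgroup.mem_comap, mem_squares]
  constructor
  · rintro ⟨y, hy⟩
    have h1 : (y : L) ^ 2 = algebraMap O L u := by simpa using congrArg Units.val hy
    have hint : IsIntegral O (y : L) := IsIntegral.of_pow two_pos (h1 ▸ isIntegral_algebraMap)
    obtain ⟨a, ha⟩ := IsIntegrallyClosed.isIntegral_iff.mp hint
    have h2 : a ^ 2 = u := by
      apply IsFractionRing.injective O L
      rw [map_pow, ha, h1]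
    have hu : IsUnit a := isUnit_of_mul_isUnit_left (y := a) (by rw [← sq, h2]; exact u.isUnit)
    exact ⟨hu.unit, Units.ext (by simpa using h2)⟩
  · rintro ⟨y, rfl⟩
    exact ⟨Units.map (algebraMap O L : O →* L) y, by simp⟩

theorem card_mul_index_squares :
    (squares Oˣ).index * Nat.card {x : ClassGroup O // x ^ 2 = 1} =
      (squares Lˣ).relIndex (idealSquares O L) := by
  rw [natCard_classGroup_sq_eq_one O L, ← relIndex_squares_unitsSubgroup O L,
    ← Subgroup.relIndex_sup_left (H := unitsSubgroup O L)]
  apply Subgroup.relIndex_mul_relIndex _ _ _ le_sup_left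
  refine sup_le ?_ ?_
  · exact Subgroup.map_le_iff_le_comap.mp (map_squares_le _)
  · rw [← ker_toPrincipalIdeal]
    exact fun x hx => by
      rw [Subgroup.mem_comap, MonoidHom.mem_ker.mp hx]; exact one_mem _

end ClassGroup

section Doubling

variable {G : Type*} [CommGroup G]

lemma relIndex_sup_zpowers_eq_two {H : Subgroup G} (hH : squares G ≤ H) {g : G} (hg : g ∉ H) :
    H.relIndex (H ⊔ Subgroup.zpowers g) = 2 := by
  have hg2 : g * g ∈ H := by rw [← sq]; exact hH (sq_mem_squares g)
  rw [Subgroup.relIndex_eq_two_iff]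
  refine ⟨g, Subgroup.mem_sup_right (Subgroup.mem_zpowers g), fun b hb => ?_⟩
  obtain ⟨h, hh, _, ⟨j, rfl⟩, rfl⟩ := Subgroup.mem_sup.mp hb
  rcases Int.even_or_odd' j with ⟨i, rfl | rfl⟩
  · have h1 : h * g ^ (2 * i) ∈ H := by
      refine mul_mem hh ?_
      rw [zpow_mul]
      exact zpow_mem (by rw [zpow_two]; exact hg2) i
    exact Or.inr ⟨h1, fun h2 => hg ((mul_mem_cancel_left h1).mp h2)⟩
  · have h1 : h * g ^ (2 * i + 1) * g ∈ H := by
      rw [zpow_add_one, mul_assoc, mul_assoc]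
      refine mul_mem hh (mul_mem ?_ hg2)
      rw [zpow_mul]
      exact zpow_mem (by rw [zpow_two]; exact hg2) i
    exact Or.inl ⟨h1, fun h2 => hg ((mul_mem_cancel_left h2).mp h1)⟩

end Doubling

section Primes

variable {R : Type*} [CommRing R] [IsDomain R] [IsPrincipalIdealRing R]
  (k : Type*) [Field k] [Algebra R k] [IsFractionRing R k]

/-- The subgroup of `kˣ` generated by the squares, the units of `R` and the elements of `s`. -/
def primesSubgroup (s : Set R) : Subgroup kˣ :=
  squares kˣ ⊔ unitsSubgroup R k ⊔ Subgroup.closure {x | ∃ p ∈ s, (x : k) = algebraMap R k p}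

/-- The height one prime generated by a prime element. -/
def heightOneOfPrime {p : R} (hp : Prime p) : IsDedekindDomain.HeightOneSpectrum R where
  asIdeal := Ideal.span {p}
  isPrime := (Ideal.span_singleton_prime hp.ne_zero).mpr hp
  ne_bot := by simpa using hp.ne_zero

variable {k}

lemma notMem_primesSubgroup {s : Set R} {p : R} (hp : Prime p) (hs : ∀ q ∈ s, ¬ p ∣ q)
    {x : kˣ} (hx : (x : k) = algebraMap R k p) : x ∉ primesSubgroup k s := by
  set v := heightOneOfPrime hp
  have hv : primesSubgroup k s ≤
      (squares (Multiplicative ℤ)).comap (v.valuationOfNeZero (K := k)) := by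
    refine sup_le (sup_le ?_ ?_) ?_
    · exact Subgroup.map_le_iff_le_comap.mp (map_squares_le _)
    · rintro _ ⟨u, rfl⟩
      rw [Subgroup.mem_comap, v.valuation_of_unit_eq u]
      exact one_mem _
    · rw [Subgroup.closure_le]
      rintro y ⟨q, hq, hy⟩
      have : v.valuationOfNeZero y = 1 := by
        rw [← WithZero.coe_inj, v.valuationOfNeZero_eq, hy, v.valuation_of_algebraMap,
          WithZero.coe_one, v.intValuation_eq_one_iff]
        rw [show v.asIdeal = Ideal.span {p} from rfl, Ideal.mem_span_singleton]
        exact hs q hq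
      rw [SetLike.mem_coe, Subgroup.mem_comap, this]
      exact one_mem _
  intro hmem
  obtain ⟨y, hy⟩ := hv hmem
  have h1 : v.valuationOfNeZero x = Multiplicative.ofAdd (-1) := by
    rw [← WithZero.coe_inj, v.valuationOfNeZero_eq, hx, v.valuation_of_algebraMap,
      v.intValuation_singleton hp.ne_zero rfl]
    rfl
  rw [h1] at hy
  have h2 := congrArg Multiplicative.toAdd hy
  simp at h2
  omega

variable (k) in
lemma relIndex_primesSubgroup (s : Finset R) (hs : ∀ p ∈ s, Prime p)
    (hs' : ∀ p ∈ s, ∀ q ∈ s, p ∣ q → p = q) :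
    (squares kˣ).relIndex (primesSubgroup k (s : Set R)) = (squares Rˣ).index * 2 ^ s.card := by
  classical
  induction s using Finset.induction_on with
  | empty =>
    have : {x : kˣ | ∃ p ∈ ((∅ : Finset R) : Set R), (x : k) = algebraMap R k p} = ∅ := by
      ext; simp
    rw [primesSubgroup, this, Subgroup.closure_empty, sup_bot_eq, Subgroup.relIndex_sup_left,
      relIndex_squares_unitsSubgroup]
    simp
  | insert p s hps ih =>
    have hp : Prime p := hs p (Finset.mem_insert_self _ _)
    have hp0 : algebraMap R k p ≠ 0 := by
      simpa using hp.ne_zero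
    set x : kˣ := Units.mk0 _ hp0
    have hx : x ∉ primesSubgroup k (s : Set R) := by
      refine notMem_primesSubgroup hp (fun q hq hpq => ?_) rfl
      have := hs' p (Finset.mem_insert_self _ _) q (Finset.mem_insert_of_mem hq) hpq
      exact hps (this ▸ hq)
    have hsq : squares kˣ ≤ primesSubgroup k (s : Set R) := le_sup_left.trans le_sup_left
    have heq : primesSubgroup k ((insert p s : Finset R) : Set R) =
        primesSubgroup k (s : Set R) ⊔ Subgroup.zpowers x := by
      have : {y : kˣ | ∃ q ∈ ((insert p s : Finset R) : Set R), (y : k) = algebraMap R k q} =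
          {y : kˣ | ∃ q ∈ (s : Set R), (y : k) = algebraMap R k q} ∪ {x} := by
        ext y
        simp only [Finset.coe_insert, Set.mem_insert_iff, exists_eq_or_imp, Set.mem_ofPred_eq,
          Set.mem_union, Set.mem_singleton_iff, Units.ext_iff, x, Units.val_mk0]
        exact or_comm
      rw [primesSubgroup, this, Subgroup.closure_union, ← sup_assoc, ← Subgroup.zpowers_eq_closure]
      rfl
    rw [heq, ← Subgroup.relIndex_mul_relIndex _ _ _ hsq le_sup_left,
      relIndex_sup_zpowers_eq_two hsq hx, ih (fun q hq => hs q (Finset.mem_insert_of_mem hq))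
        (fun q hq r hr => hs' q (Finset.mem_insert_of_mem hq) r (Finset.mem_insert_of_mem hr)),
      Finset.card_insert_of_notMem hps, pow_succ, mul_assoc]

end Primes

open QuadraticAlgebra

section Extension

variable {R : Type*} [CommRing R] (k : Type*) [Field k] [Algebra R k] (d : R)

/-- Base change of the quadratic algebra `R[√d]` to an `R`-algebra `k`. -/
noncomputable instance quadraticAlgebraBaseChange :
    Algebra (QuadraticAlgebra R d 0) (QuadraticAlgebra k (algebraMap R k d) 0) :=
  RingHom.toAlgebra
    { toFun := fun z => ⟨algebraMap R k z.re, algebraMap R k z.im⟩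
      map_one' := by ext <;> simp
      map_zero' := by ext <;> simp
      map_mul' := fun z w => by ext <;> simp
      map_add' := fun z w => by ext <;> simp }

variable {k d}

@[simp] lemma re_algebraMap_baseChange (z : QuadraticAlgebra R d 0) :
    (algebraMap _ (QuadraticAlgebra k (algebraMap R k d) 0) z).re = algebraMap R k z.re := rfl

@[simp] lemma im_algebraMap_baseChange (z : QuadraticAlgebra R d 0) :
    (algebraMap _ (QuadraticAlgebra k (algebraMap R k d) 0) z).im = algebraMap R k z.im := rfl

lemma norm_algebraMap_baseChange (z : QuadraticAlgebra R d 0) :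
    norm (algebraMap _ (QuadraticAlgebra k (algebraMap R k d) 0) z) = algebraMap R k (norm z) := by
  simp [norm_def]

variable [IsDomain R] [IsFractionRing R k] [Fact (∀ r : k, r ^ 2 ≠ algebraMap R k d + 0 * r)]

omit [IsDomain R] [Fact (∀ r : k, r ^ 2 ≠ algebraMap R k d + 0 * r)] in
lemma injective_algebraMap_baseChange :
    Function.Injective (algebraMap (QuadraticAlgebra R d 0)
      (QuadraticAlgebra k (algebraMap R k d) 0)) := by
  intro z w h
  have hinj := IsFractionRing.injective R k
  ext
  · exact hinj (congrArg QuadraticAlgebra.re h)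
  · exact hinj (congrArg QuadraticAlgebra.im h)

variable (k d) in
include k in
omit [IsDomain R] in
lemma isDomain_quadraticAlgebra : IsDomain (QuadraticAlgebra R d 0) :=
  (injective_algebraMap_baseChange (k := k) (d := d)).isDomain _

omit [Fact (∀ r : k, r ^ 2 ≠ algebraMap R k d + 0 * r)] in
lemma exists_eq_div_baseChange (x : QuadraticAlgebra k (algebraMap R k d) 0) :
    ∃ (α : QuadraticAlgebra R d 0) (m : R), m ≠ 0 ∧
      x * algebraMap k _ (algebraMap R k m) = algebraMap _ _ α := by
  classical
  obtain ⟨m, hm⟩ := IsLocalization.exist_integer_multiples_of_finset R⁰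
    ({x.re, x.im} : Finset k)
  obtain ⟨a, ha⟩ := hm x.re (by simp)
  obtain ⟨b, hb⟩ := hm x.im (by simp)
  refine ⟨⟨a, b⟩, m, nonZeroDivisors.coe_ne_zero m, ?_⟩
  rw [Algebra.smul_def] at ha hb
  ext
  · simp [ha, mul_comm]
  · simp [hb, mul_comm]

instance isFractionRing_baseChange : IsFractionRing (QuadraticAlgebra R d 0)
    (QuadraticAlgebra k (algebraMap R k d) 0) := by
  have := isDomain_quadraticAlgebra k d
  have : FaithfulSMul (QuadraticAlgebra R d 0) (QuadraticAlgebra k (algebraMap R k d) 0) :=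
    (faithfulSMul_iff_algebraMap_injective _ _).mpr injective_algebraMap_baseChange
  refine IsFractionRing.of_field _ _ fun z => ?_
  obtain ⟨α, m, hm, h⟩ := exists_eq_div_baseChange z
  refine ⟨α, algebraMap R _ m, ?_⟩
  have h0 : algebraMap k (QuadraticAlgebra k (algebraMap R k d) 0) (algebraMap R k m) ≠ 0 := by
    simpa using hm
  rw [← h]
  have : algebraMap (QuadraticAlgebra R d 0) (QuadraticAlgebra k (algebraMap R k d) 0)
      (algebraMap R _ m) = algebraMap k _ (algebraMap R k m) := by
    ext <;> simp
  rw [this, mul_div_cancel_right₀ _ h0]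

end Extension

section Norm

variable {k : Type*} [Field k] {a : k} [Fact (∀ r : k, r ^ 2 ≠ a + 0 * r)]

variable (k a) in
/-- The norm map on unit groups. -/
noncomputable abbrev unitsNorm : (QuadraticAlgebra k a 0)ˣ →* kˣ := Units.map (norm : _ →* k)

variable (k a) in
/-- The inclusion map on unit groups. -/
noncomputable abbrev unitsIncl : kˣ →* (QuadraticAlgebra k a 0)ˣ :=
  Units.map (algebraMap k (QuadraticAlgebra k a 0) : _ →* _)

lemma unitsNorm_unitsIncl (x : kˣ) : unitsNorm k a (unitsIncl k a x) = x ^ 2 := by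
  ext; simp

lemma exists_eq_incl_mul_sq_of_norm [NeZero (2 : k)] {x : (QuadraticAlgebra k a 0)ˣ}
    (hx : unitsNorm k a x ∈ squares kˣ) : ∃ c y, unitsIncl k a c * y ^ 2 = x := by
  have key : ∀ s : kˣ, s ^ 2 = unitsNorm k a x → (x : QuadraticAlgebra k a 0).re + s ≠ 0 →
      ∃ c y, unitsIncl k a c * y ^ 2 = x := by
    intro s hs hne
    have hs' : (x : QuadraticAlgebra k a 0).re ^ 2 - a * (x : QuadraticAlgebra k a 0).im ^ 2
        = (s : k) ^ 2 := by
      have := congrArg Units.val hs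
      simp [norm_def] at this
      rw [this]; ring
    have h2 : (2 * ((x : QuadraticAlgebra k a 0).re + s)) ≠ 0 := mul_ne_zero two_ne_zero hne
    have hy : (x : QuadraticAlgebra k a 0) + algebraMap k _ (s : k) ≠ 0 := by
      intro h
      exact hne (by simpa using congrArg QuadraticAlgebra.re h)
    have hmul : (x : QuadraticAlgebra k a 0) *
        algebraMap k _ (2 * ((x : QuadraticAlgebra k a 0).re + s)) =
        ((x : QuadraticAlgebra k a 0) + algebraMap k _ (s : k)) ^ 2 := by
      rw [sq]
      ext
      · simp only [re_mul, re_add, im_add, algebraMap_re, algebraMap_im]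
        linear_combination hs'
      · simp only [im_mul, re_add, im_add, algebraMap_re, algebraMap_im]
        ring
    refine ⟨(Units.mk0 _ h2)⁻¹, Units.mk0 _ hy, ?_⟩
    rw [map_inv, inv_mul_eq_iff_eq_mul]
    ext1
    simp only [Units.val_pow_eq_pow_val, Units.val_mk0, Units.val_mul, Units.coe_map,
      MonoidHom.coe_coe]
    rw [← hmul, mul_comm]
  obtain ⟨s, hs⟩ := hx
  replace hs : s ^ 2 = unitsNorm k a x := hs
  by_cases h : (x : QuadraticAlgebra k a 0).re + s = 0
  · refine key (-s) (by rw [neg_sq, hs]) fun h' => ?_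
    have h2 : (2 : k) * s = 0 := by
      rw [Units.val_neg] at h'
      linear_combination h - h'
    exact mul_ne_zero two_ne_zero s.ne_zero h2
  · exact key s hs h

lemma mem_squares_of_incl_mem_squares [NeZero (2 : k)] {c g : kˣ} (hg : (g : k) = a)
    (hc : unitsIncl k a c ∈ squares _) : c ∈ squares kˣ ⊔ Subgroup.zpowers g := by
  obtain ⟨y, hy⟩ := hc
  have h : (y : QuadraticAlgebra k a 0) * y = algebraMap k _ (c : k) := by
    simpa [sq] using congrArg Units.val hy
  have hre := congrArg QuadraticAlgebra.re h
  have him := congrArg QuadraticAlgebra.im h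
  simp only [re_mul, im_mul, algebraMap_re, algebraMap_im] at hre him
  have h3 : (y : QuadraticAlgebra k a 0).re * (y : QuadraticAlgebra k a 0).im = 0 := by
    have : (2 : k) * ((y : QuadraticAlgebra k a 0).re * (y : QuadraticAlgebra k a 0).im) = 0 := by
      linear_combination him
    exact (mul_eq_zero.mp this).resolve_left two_ne_zero
  rcases mul_eq_zero.mp h3 with h0 | h0
  · have hne : (y : QuadraticAlgebra k a 0).im ≠ 0 := by
      intro h1
      exact y.ne_zero (by ext <;> simp [h0, h1])
    have : c = Units.mk0 _ hne ^ 2 * g := by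
      ext
      simp only [Units.val_mul, Units.val_pow_eq_pow_val, Units.val_mk0, hg]
      rw [← hre, h0]; ring
    rw [this]
    exact mul_mem (Subgroup.mem_sup_left (sq_mem_squares _))
      (Subgroup.mem_sup_right (Subgroup.mem_zpowers g))
  · have hne : (y : QuadraticAlgebra k a 0).re ≠ 0 := by
      intro h1
      exact y.ne_zero (by ext <;> simp [h0, h1])
    have : c = Units.mk0 _ hne ^ 2 := by
      ext
      simp only [Units.val_pow_eq_pow_val, Units.val_mk0]
      rw [← hre, h0]; ring
    rw [this]
    exact Subgroup.mem_sup_left (sq_mem_squares _)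

lemma incl_mem_squares_of_mem {c g : kˣ} (hg : (g : k) = a)
    (hc : c ∈ squares kˣ ⊔ Subgroup.zpowers g) : unitsIncl k a c ∈ squares _ := by
  have : squares kˣ ⊔ Subgroup.zpowers g ≤ (squares _).comap (unitsIncl k a) := by
    refine sup_le (Subgroup.map_le_iff_le_comap.mp (map_squares_le _)) ?_
    rw [Subgroup.zpowers_le, Subgroup.mem_comap]
    have hne : (ω : QuadraticAlgebra k a 0) ≠ 0 := by
      intro h
      simpa using congrArg QuadraticAlgebra.im h
    refine ⟨Units.mk0 ω hne, ?_⟩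
    ext <;> simp [hg, sq]
  exact this hc

end Norm

section IdealSquares

variable {O L : Type*} [CommRing O] [IsDedekindDomain O] [Field L] [Algebra O L]
  [IsFractionRing O L]

lemma mem_idealSquares_iff {α : O} {x : Lˣ} (hx : (x : L) = algebraMap O L α) :
    x ∈ idealSquares O L ↔ ∃ I : Ideal O, I * I = Ideal.span {α} := by
  have hα : α ≠ 0 := by
    rintro rfl
    simp at hx
  constructor
  · rintro ⟨J, hJ⟩
    have h1 : (J : FractionalIdeal O⁰ L) * J = (Ideal.span {α} : Ideal O) := by
      have := congrArg Units.val hJ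
      rw [coe_toPrincipalIdeal, hx, ← FractionalIdeal.coeIdeal_span_singleton] at this
      rw [← this]
      simp [sq]
    have hle : (J : FractionalIdeal O⁰ L) ≤ 1 := by
      intro z hz
      have hzz := FractionalIdeal.mul_mem_mul hz hz
      rw [h1] at hzz
      obtain ⟨a, -, ha⟩ := (FractionalIdeal.mem_coeIdeal _).mp hzz
      have hint : IsIntegral O z := by
        refine IsIntegral.of_pow (n := 2) two_pos ?_
        rw [sq, ← ha]
        exact isIntegral_algebraMap
      rw [FractionalIdeal.mem_one_iff]
      exact IsIntegrallyClosed.isIntegral_iff.mp hint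
    obtain ⟨I, hI⟩ := FractionalIdeal.le_one_iff_exists_coeIdeal.mp hle
    refine ⟨I, ?_⟩
    rw [← hI, ← FractionalIdeal.coeIdeal_mul, FractionalIdeal.coeIdeal_inj] at h1
    exact h1
  · rintro ⟨I, hI⟩
    have hI0 : (I : FractionalIdeal O⁰ L) ≠ 0 := by
      rw [FractionalIdeal.coeIdeal_ne_zero]
      rintro rfl
      rw [eq_comm, ← Ideal.zero_eq_bot, zero_mul, Ideal.zero_eq_bot,
        Ideal.span_singleton_eq_bot] at hI
      exact hα hI
    refine ⟨Units.mk0 _ hI0, ?_⟩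
    ext1
    rw [coe_toPrincipalIdeal, hx, ← FractionalIdeal.coeIdeal_span_singleton, ← hI]
    simp [sq]

lemma unitsSubgroup_le_idealSquares : unitsSubgroup O L ≤ idealSquares O L := by
  rw [← ker_toPrincipalIdeal]
  intro x hx
  rw [Subgroup.mem_comap, MonoidHom.mem_ker.mp hx]
  exact one_mem _

lemma squares_le_idealSquares : squares Lˣ ≤ idealSquares O L :=
  Subgroup.map_le_iff_le_comap.mp (map_squares_le _)

end IdealSquares

section Selmer

variable {R : Type*} [CommRing R] [IsDomain R] [IsPrincipalIdealRing R] {d : R}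

omit [IsDomain R] [IsPrincipalIdealRing R] in
lemma span_pair_mul_self_of_dvd {p e : R} (hd : d = p * e) (hpe : IsCoprime p e) :
    Ideal.span {algebraMap R (QuadraticAlgebra R d 0) p, ω} *
      Ideal.span {algebraMap R (QuadraticAlgebra R d 0) p, ω} =
      Ideal.span {algebraMap R (QuadraticAlgebra R d 0) p} := by
  have hω : (ω * ω : QuadraticAlgebra R d 0) = algebraMap R _ p * algebraMap R _ e := by
    rw [← map_mul, ← hd]
    ext <;> simp
  rw [Ideal.span_pair_mul_span_pair, hω]
  apply le_antisymm
  · rw [Ideal.span_le]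
    rintro z (rfl | rfl | rfl | rfl)
    · exact Ideal.mul_mem_right _ _ (Ideal.mem_span_singleton_self _)
    · exact Ideal.mul_mem_right _ _ (Ideal.mem_span_singleton_self _)
    · exact Ideal.mul_mem_left _ _ (Ideal.mem_span_singleton_self _)
    · exact Ideal.mul_mem_right _ _ (Ideal.mem_span_singleton_self _)
  · rw [Ideal.span_singleton_le_iff_mem]
    obtain ⟨a, b, hab⟩ := hpe
    have : algebraMap R (QuadraticAlgebra R d 0) p =
        algebraMap R _ a * (algebraMap R _ p * algebraMap R _ p) +
        algebraMap R _ b * (algebraMap R _ p * algebraMap R _ e) := by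
      simp only [← map_mul, ← map_add]
      congr 1
      linear_combination -p * hab
    refine (congrArg (· ∈ _) this).mpr (add_mem (Ideal.mul_mem_left _ _ (Ideal.subset_span ?_))
      (Ideal.mul_mem_left _ _ (Ideal.subset_span ?_))) <;> simp

omit [IsDomain R] [IsPrincipalIdealRing R] in
lemma sq_dvd_of_ideal_sq_eq {p c : R} (hp : Prime p) (hpd : ¬ p ∣ d) (hp2 : ¬ p ∣ 2) (hpc : p ∣ c)
    {I : Ideal (QuadraticAlgebra R d 0)} (hI : I * I = Ideal.span {algebraMap R _ c}) :
    p * p ∣ c := by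
  have hle : I ≤ Ideal.span {algebraMap R (QuadraticAlgebra R d 0) p} := by
    intro z hz
    have hzz := Ideal.mul_mem_mul hz hz
    rw [hI, Ideal.mem_span_singleton, algebraMap_dvd_iff] at hzz
    obtain ⟨h1, h2⟩ := hzz
    replace h1 := hpc.trans h1
    replace h2 := hpc.trans h2
    simp only [re_mul, im_mul, zero_mul, add_zero] at h1 h2
    have h3 : p ∣ z.re * z.im := by
      refine (hp.dvd_or_dvd (a := 2) ?_).resolve_left hp2
      convert h2 using 1
      ring
    rw [Ideal.mem_span_singleton, algebraMap_dvd_iff]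
    rcases hp.dvd_or_dvd h3 with h | h
    · refine ⟨h, ?_⟩
      rw [dvd_add_right (h.mul_right _), mul_assoc] at h1
      have := (hp.dvd_or_dvd h1).resolve_left hpd
      rcases hp.dvd_or_dvd this with h | h <;> exact h
    · refine ⟨?_, h⟩
      rw [dvd_add_left (h.mul_left _)] at h1
      rcases hp.dvd_or_dvd h1 with h | h <;> exact h
  have h := Ideal.mul_mono hle hle
  rw [hI, Ideal.span_singleton_mul_span_singleton, Ideal.span_singleton_le_span_singleton,
    ← map_mul, algebraMap_dvd_iff] at h
  simpa using h.1

omit [IsDomain R] [IsPrincipalIdealRing R] in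
lemma span_pair_mul_self_of_norm {α : QuadraticAlgebra R d 0} {m : R} {u : Rˣ}
    (h : norm α = u * m ^ 2) (hcop : IsCoprime (2 * α.re) m) :
    Ideal.span {α, algebraMap R _ m} * Ideal.span {α, algebraMap R _ m} = Ideal.span {α} := by
  have hm : algebraMap R (QuadraticAlgebra R d 0) m * algebraMap R _ m =
      α * (star α * algebraMap R _ (u⁻¹ : Rˣ)) := by
    rw [← mul_assoc, ← algebraMap_norm_eq_mul_star, h, ← map_mul, ← map_mul, mul_right_comm,
      Units.mul_inv, one_mul, sq]
  rw [Ideal.span_pair_mul_span_pair, hm]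
  apply le_antisymm
  · rw [Ideal.span_le]
    rintro z (rfl | rfl | rfl | rfl)
    · exact Ideal.mul_mem_right _ _ (Ideal.mem_span_singleton_self _)
    · exact Ideal.mul_mem_right _ _ (Ideal.mem_span_singleton_self _)
    · exact Ideal.mul_mem_left _ _ (Ideal.mem_span_singleton_self _)
    · exact Ideal.mul_mem_right _ _ (Ideal.mem_span_singleton_self _)
  · rw [Ideal.span_singleton_le_iff_mem]
    obtain ⟨a, b, hab⟩ := hcop
    have htr : α + star α = algebraMap R _ (2 * α.re) := by
      ext
      · simp; ring
      · simp
    have h1 := congrArg (algebraMap R (QuadraticAlgebra R d 0)) hab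
    rw [map_add, map_mul _ a, map_mul _ b, ← htr, map_one] at h1
    have hu : algebraMap R (QuadraticAlgebra R d 0) (u : R) * algebraMap R _ (u⁻¹ : Rˣ) = 1 := by
      rw [← map_mul, Units.mul_inv, map_one]
    have : α = algebraMap R _ a * (α * α) +
        (algebraMap R _ a * algebraMap R _ (u : R)) * (α * (star α * algebraMap R _ (u⁻¹ : Rˣ))) +
        algebraMap R _ b * (α * algebraMap R _ m) := by
      linear_combination (-α) * h1 - algebraMap R _ a * α * star α * hu
    refine (congrArg (· ∈ _) this).mpr (add_mem (add_mem ?_ ?_) ?_) <;>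
      refine Ideal.mul_mem_left _ _ (Ideal.subset_span ?_) <;> simp

lemma isCoprime_of_norm_eq {α : QuadraticAlgebra R d 0} {m : R} {u : Rˣ}
    (h2 : ∀ p : R, Prime p → p ∣ 2 → p ∣ d) (hd2 : ∀ p : R, Prime p → ¬ p * p ∣ d)
    (hα : IsCoprime α.re α.im) (h : norm α = u * m ^ 2) {p : R} (hp : Prime p) (hpm : p ∣ m) :
    ¬ p ∣ 2 * α.re := by
  have h' : α.re * α.re - d * α.im * α.im = u * m ^ 2 := by
    rw [← h, norm_def]; ring
  intro hpx
  have hpx : p ∣ α.re := by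
    rcases hp.dvd_or_dvd hpx with hp2 | hpx
    · have : p ∣ α.re * α.re := by
        rw [show α.re * α.re = d * (α.im * α.im) + u * m * m by linear_combination h']
        exact dvd_add ((h2 p hp hp2).mul_right _) (hpm.mul_left _)
      rcases hp.dvd_or_dvd this with h | h <;> exact h
    · exact hpx
  have hpy : ¬ p ∣ α.im := fun hpy => hp.not_isUnit (hα.isUnit_of_dvd' hpx hpy)
  apply hd2 p hp
  have hcop : IsCoprime (p * p) (α.im * α.im) := by
    have := (hp.coprime_iff_not_dvd.mpr hpy)
    exact (this.mul_left this).mul_right (this.mul_left this)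
  refine hcop.dvd_of_dvd_mul_right ?_
  rw [show d * (α.im * α.im) = α.re * α.re - u * (m * m) by linear_combination -h']
  exact dvd_sub (mul_dvd_mul hpx hpx) ((mul_dvd_mul hpm hpm).mul_left _)

lemma exists_isCoprime_mul (x y : R) (h : x ≠ 0 ∨ y ≠ 0) :
    ∃ g x' y', g ≠ 0 ∧ x = g * x' ∧ y = g * y' ∧ IsCoprime x' y' := by
  have key : ∀ x y : R, x ≠ 0 → ∃ g x' y', g ≠ 0 ∧ x = g * x' ∧ y = g * y' ∧ IsCoprime x' y' := by
    intro x y hx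
    obtain ⟨x', y', g, h1, rfl, rfl⟩ := UniqueFactorizationMonoid.exists_reduced_factors x hx y
    exact ⟨g, x', y', left_ne_zero_of_mul hx, rfl, rfl, h1.isCoprime⟩
  rcases h with h | h
  · exact key x y h
  · obtain ⟨g, a, b, h1, h2, h3, h4⟩ := key y x h
    exact ⟨g, b, a, h1, h3, h2, h4.symm⟩

end Selmer

section SelmerCount

variable {R : Type*} [CommRing R] [IsDomain R] [IsPrincipalIdealRing R]
  {k : Type*} [Field k] [Algebra R k] [IsFractionRing R k] {d : R}
  [Fact (∀ r : k, r ^ 2 ≠ algebraMap R k d + 0 * r)] [IsDedekindDomain (QuadraticAlgebra R d 0)]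

lemma comap_unitsIncl_idealSquares {s : Set R} (hs : ∀ p ∈ s, Prime p ∧ p ∣ d)
    (hs' : ∀ p : R, Prime p → p ∣ d → ∃ q ∈ s, Associated p q)
    (h2 : ∀ p : R, Prime p → p ∣ 2 → p ∣ d) (hd2 : ∀ p : R, Prime p → ¬ p * p ∣ d) :
    (idealSquares (QuadraticAlgebra R d 0) (QuadraticAlgebra k (algebraMap R k d) 0)).comap
      (unitsIncl k (algebraMap R k d)) = primesSubgroup k s := by
  set S := idealSquares (QuadraticAlgebra R d 0) (QuadraticAlgebra k (algebraMap R k d) 0)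
  have hcompat : ∀ (c : kˣ) (a : R), (c : k) = algebraMap R k a →
      (unitsIncl k (algebraMap R k d) c : QuadraticAlgebra k (algebraMap R k d) 0) =
        algebraMap (QuadraticAlgebra R d 0) _ (algebraMap R _ a) := by
    intro c a h
    rw [Units.coe_map, MonoidHom.coe_coe, h]
    ext <;> simp
  have hsq : squares kˣ ≤ S.comap (unitsIncl k (algebraMap R k d)) := by
    rintro _ ⟨y, rfl⟩
    rw [Subgroup.mem_comap, powMonoidHom_apply, map_pow]
    exact squares_le_idealSquares (sq_mem_squares _)
  apply le_antisymm
  · have key : ∀ a : R, ∀ c : kˣ, (c : k) = algebraMap R k a →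
      unitsIncl k (algebraMap R k d) c ∈ S →
        c ∈ primesSubgroup k s := by
      intro a
      induction a using (wellFounded_dvdNotUnit (α := R)).induction with
      | h a ih =>
      intro c hc hcS
      have ha : a ≠ 0 := by
        rintro rfl
        simp at hc
      by_cases hu : IsUnit a
      · refine Subgroup.mem_sup_left (Subgroup.mem_sup_right ⟨hu.unit, ?_⟩)
        ext
        simp [hc]
      obtain ⟨p, hp, hpa⟩ := WfDvdMonoid.exists_irreducible_factor hu ha
      rw [irreducible_iff_prime] at hp
      obtain ⟨b, rfl⟩ := hpa
      have hb : b ≠ 0 := right_ne_zero_of_mul ha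
      have hpk : algebraMap R k p ≠ 0 := by simpa using hp.ne_zero
      set π : kˣ := Units.mk0 _ hpk
      by_cases hpd : p ∣ d
      · have hπ : π ∈ primesSubgroup k s := by
          obtain ⟨q, hq, u, hu⟩ := hs' p hp hpd
          have : π = Units.mk0 (algebraMap R k q) (by simpa using (hs q hq).1.ne_zero) *
              Units.map (algebraMap R k : R →* k) u⁻¹ := by
            ext
            simp only [π, Units.val_mul, Units.val_mk0, Units.coe_map, MonoidHom.coe_coe, ← map_mul]
            rw [← hu, mul_assoc, Units.mul_inv, mul_one]
          rw [this]
          exact mul_mem (Subgroup.mem_sup_right (Subgroup.subset_closure ⟨q, hq, rfl⟩))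
            (Subgroup.mem_sup_left (Subgroup.mem_sup_right ⟨_, rfl⟩))
        have hπS : unitsIncl k (algebraMap R k d) π ∈ S := by
          obtain ⟨e, he⟩ := hpd
          have hpe : ¬ p ∣ e := by
            rintro ⟨e', rfl⟩
            exact hd2 p hp ⟨e', by rw [he, mul_assoc]⟩
          rw [mem_idealSquares_iff (hcompat π p rfl)]
          exact ⟨_, span_pair_mul_self_of_dvd he (hp.coprime_iff_not_dvd.mpr hpe)⟩
        have h1 : c * π⁻¹ ∈ primesSubgroup k s := by
          refine ih b ⟨hb, p, hp.not_isUnit, mul_comm _ _⟩ _ ?_ ?_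
          · rw [Units.val_mul, hc, map_mul, Units.val_inv_eq_inv_val]
            simp only [π, Units.val_mk0]
            field_simp
          · rw [map_mul, map_inv]
            exact mul_mem hcS (inv_mem hπS)
        simpa using mul_mem h1 hπ
      · have hp2 : ¬ p ∣ 2 := fun h => hpd (h2 p hp h)
        obtain ⟨I, hI⟩ := (mem_idealSquares_iff (hcompat c _ hc)).mp hcS
        obtain ⟨b', hb'⟩ := sq_dvd_of_ideal_sq_eq hp hpd hp2 (dvd_mul_right p b) hI
        have hπS : π ^ 2 ∈ S.comap (unitsIncl k (algebraMap R k d)) := hsq (sq_mem_squares _)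
        have hπ : π ^ 2 ∈ primesSubgroup k s :=
          Subgroup.mem_sup_left (Subgroup.mem_sup_left (sq_mem_squares _))
        have h1 : c * (π ^ 2)⁻¹ ∈ primesSubgroup k s := by
          have hb'0 : b' ≠ 0 := by
            rintro rfl
            rw [mul_zero] at hb'
            exact ha hb'
          refine ih b' ⟨hb'0, p * p, fun h => hp.not_isUnit (isUnit_of_mul_isUnit_left h),
            by rw [hb', mul_comm]⟩ _ ?_ ?_
          · rw [Units.val_mul, hc, hb', map_mul, Units.val_inv_eq_inv_val, map_mul,
              Units.val_pow_eq_pow_val]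
            simp only [π, Units.val_mk0]
            field_simp
          · rw [map_mul, map_inv]
            exact mul_mem hcS (inv_mem hπS)
        simpa using mul_mem h1 hπ
    intro c hc
    obtain ⟨a, b, hb, hab⟩ := IsFractionRing.div_surjective R (c : k)
    have hbk : algebraMap R k b ≠ 0 := by simpa using nonZeroDivisors.ne_zero hb
    set β : kˣ := Units.mk0 _ hbk
    have h1 : c * β ^ 2 ∈ primesSubgroup k s := by
      refine key (a * b) _ ?_ ?_
      · rw [Units.val_mul, Units.val_pow_eq_pow_val, ← hab, map_mul]
        simp only [β, Units.val_mk0]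
        field_simp
      · rw [map_mul]
        exact mul_mem hc (hsq (sq_mem_squares β))
    have h2 : β ^ 2 ∈ primesSubgroup k s :=
      Subgroup.mem_sup_left (Subgroup.mem_sup_left (sq_mem_squares _))
    simpa using mul_mem h1 (inv_mem h2)
  · refine sup_le (sup_le hsq ?_) ?_
    · rintro _ ⟨u, rfl⟩
      rw [Subgroup.mem_comap]
      apply unitsSubgroup_le_idealSquares
      refine ⟨Units.map (algebraMap R (QuadraticAlgebra R d 0) : R →* _) u, ?_⟩
      ext <;> simp
    · rw [Subgroup.closure_le]
      rintro π ⟨p, hps, hπ⟩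
      obtain ⟨hp, e, he⟩ := hs p hps
      have hpe : ¬ p ∣ e := by
        rintro ⟨e', rfl⟩
        exact hd2 p hp ⟨e', by rw [he, mul_assoc]⟩
      rw [SetLike.mem_coe, Subgroup.mem_comap, mem_idealSquares_iff (hcompat π p hπ)]
      exact ⟨_, span_pair_mul_self_of_dvd he (hp.coprime_iff_not_dvd.mpr hpe)⟩

lemma norm_mem_of_mem_idealSquares {x : (QuadraticAlgebra k (algebraMap R k d) 0)ˣ}
    (hx : x ∈ idealSquares (QuadraticAlgebra R d 0) (QuadraticAlgebra k (algebraMap R k d) 0)) :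
    unitsNorm k _ x ∈ unitsSubgroup R k ⊔ squares kˣ := by
  obtain ⟨α, m, hm, h⟩ := exists_eq_div_baseChange (x : QuadraticAlgebra k (algebraMap R k d) 0)
  have hmk : algebraMap R k m ≠ 0 := by simpa using hm
  set μ : kˣ := Units.mk0 _ hmk
  have h' : ((x * (unitsIncl k _ μ) ^ 2 : (QuadraticAlgebra k (algebraMap R k d) 0)ˣ) :
      QuadraticAlgebra k (algebraMap R k d) 0) =
      algebraMap (QuadraticAlgebra R d 0) _ (α * algebraMap R _ m) := by
    rw [map_mul, ← h, Units.val_mul, Units.val_pow_eq_pow_val, sq, ← mul_assoc]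
    congr 1
    ext <;> simp [μ]
  have hmem : x * (unitsIncl k _ μ) ^ 2 ∈ idealSquares (QuadraticAlgebra R d 0)
      (QuadraticAlgebra k (algebraMap R k d) 0) :=
    mul_mem hx (squares_le_idealSquares (sq_mem_squares _))
  obtain ⟨I, hI⟩ := (mem_idealSquares_iff h').mp hmem
  set γ := α * algebraMap R (QuadraticAlgebra R d 0) m
  have hnorm : Algebra.intNorm R (QuadraticAlgebra R d 0) γ = norm γ := by
    rw [Algebra.intNorm_eq_norm, ← det_toLinearMap_eq_norm, Algebra.norm_apply]
    rfl
  have h1 := congrArg (Ideal.relNorm R) hI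
  obtain ⟨g, hg⟩ := (IsPrincipalIdealRing.principal (Ideal.relNorm R I)).principal
  rw [map_mul, Ideal.relNorm_singleton, hnorm, hg, ← Ideal.span,
    Ideal.span_singleton_mul_span_singleton, Ideal.span_singleton_eq_span_singleton] at h1
  obtain ⟨u, hu⟩ := h1
  have hN : ((unitsNorm k _ (x * (unitsIncl k _ μ) ^ 2) : kˣ) : k) =
      algebraMap R k g ^ 2 * algebraMap R k u := by
    rw [Units.coe_map, h', norm_algebraMap_baseChange, ← hu]
    simp [sq]
  have hg0 : algebraMap R k g ≠ 0 := by
    intro h0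
    rw [h0] at hN
    exact Units.ne_zero _ (hN.trans (by simp))
  have hN' : unitsNorm k _ (x * (unitsIncl k _ μ) ^ 2) =
      Units.mk0 _ hg0 ^ 2 * Units.map (algebraMap R k : R →* k) u := by
    ext
    rw [hN]
    simp
  rw [map_mul, map_pow, unitsNorm_unitsIncl] at hN'
  rw [eq_mul_inv_of_mul_eq hN']
  refine mul_mem (mul_mem (Subgroup.mem_sup_right (sq_mem_squares _))
    (Subgroup.mem_sup_left ⟨_, rfl⟩)) (inv_mem (Subgroup.mem_sup_right (sq_mem_squares _)))

omit [IsDedekindDomain (QuadraticAlgebra R d 0)] in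
lemma exists_isCoprime_norm_eq {x : (QuadraticAlgebra k (algebraMap R k d) 0)ˣ} {u : Rˣ} {s : kˣ}
    (hx : unitsNorm k _ x = Units.map (algebraMap R k : R →* k) u * s ^ 2) :
    ∃ (α : QuadraticAlgebra R d 0) (m : R) (c : kˣ), IsCoprime α.re α.im ∧ norm α = u * m ^ 2 ∧
      ((unitsIncl k _ c * x : (QuadraticAlgebra k (algebraMap R k d) 0)ˣ) :
        QuadraticAlgebra k (algebraMap R k d) 0) = algebraMap (QuadraticAlgebra R d 0) _ α := by
  obtain ⟨α, m, hm, h⟩ := exists_eq_div_baseChange (x : QuadraticAlgebra k (algebraMap R k d) 0)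
  have hmk : algebraMap R k m ≠ 0 := by simpa using hm
  have hmL : algebraMap k (QuadraticAlgebra k (algebraMap R k d) 0) (algebraMap R k m) ≠ 0 := by
    simpa using hm
  have hα : α.re ≠ 0 ∨ α.im ≠ 0 := by
    by_contra! h0
    have : α = 0 := by ext <;> simp [h0]
    rw [this, map_zero] at h
    exact mul_ne_zero x.ne_zero hmL h
  obtain ⟨g, a, b, hg, ha, hb, hab⟩ := exists_isCoprime_mul _ _ hα
  have hgk : algebraMap R k g ≠ 0 := by simpa using hg
  set c : kˣ := Units.mk0 _ hmk / Units.mk0 _ hgk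
  have hc : ((unitsIncl k _ c * x : (QuadraticAlgebra k (algebraMap R k d) 0)ˣ) :
        QuadraticAlgebra k (algebraMap R k d) 0) =
        algebraMap (QuadraticAlgebra R d 0) _ ⟨a, b⟩ := by
    have hre := congrArg QuadraticAlgebra.re h
    have him := congrArg QuadraticAlgebra.im h
    simp only [re_mul, im_mul, algebraMap_re, algebraMap_im, re_algebraMap_baseChange,
      im_algebraMap_baseChange, ha, hb, map_mul, mul_zero, add_zero, zero_add] at hre him
    ext
    · simp [c]
      field_simp
      linear_combination hre
    · simp [c]
      field_simp
      linear_combination him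
  have hN : algebraMap R k (norm (⟨a, b⟩ : QuadraticAlgebra R d 0)) =
      algebraMap R k u * ((c : k) * s) ^ 2 := by
    rw [← norm_algebraMap_baseChange, ← hc]
    have := congrArg (Units.val) (congrArg (fun z => c ^ 2 * z) hx)
    simp only [Units.val_mul, Units.coe_map, MonoidHom.coe_coe, Units.val_pow_eq_pow_val] at this
    rw [Units.val_mul, map_mul, Units.coe_map, MonoidHom.coe_coe, QuadraticAlgebra.norm_algebraMap,
      this]
    ring
  have hint : IsIntegral R ((c : k) * s) := by
    refine IsIntegral.of_pow (n := 2) two_pos ?_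
    have : ((c : k) * s) ^ 2 =
        algebraMap R k ((u⁻¹ : Rˣ) * norm (⟨a, b⟩ : QuadraticAlgebra R d 0)) := by
      rw [map_mul, hN, ← mul_assoc, ← map_mul, Units.inv_mul, map_one, one_mul]
    rw [this]
    exact isIntegral_algebraMap
  obtain ⟨m', hm'⟩ := IsIntegrallyClosed.isIntegral_iff.mp hint
  refine ⟨⟨a, b⟩, m', c, hab, ?_, hc⟩
  apply IsFractionRing.injective R k
  rw [hN, map_mul, map_pow, hm']

lemma map_norm_idealSquares [NeZero (2 : R)]
    (h2 : ∀ p : R, Prime p → p ∣ 2 → p ∣ d) (hd2 : ∀ p : R, Prime p → ¬ p * p ∣ d) :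
    (idealSquares (QuadraticAlgebra R d 0) (QuadraticAlgebra k (algebraMap R k d) 0)).map
      (unitsNorm k (algebraMap R k d)) ⊔ squares kˣ =
    (unitsNorm k (algebraMap R k d)).range ⊓ (unitsSubgroup R k ⊔ squares kˣ) := by
  apply le_antisymm
  · refine sup_le ?_ (le_inf ?_ le_sup_right)
    · rintro _ ⟨x, hx, rfl⟩
      exact ⟨⟨x, rfl⟩, norm_mem_of_mem_idealSquares hx⟩
    · rintro _ ⟨y, rfl⟩
      exact ⟨unitsIncl k _ y, unitsNorm_unitsIncl y⟩
  · rintro _ ⟨⟨x, rfl⟩, hx⟩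
    obtain ⟨_, ⟨u, rfl⟩, _, ⟨s, rfl⟩, hus⟩ := Subgroup.mem_sup.mp hx
    obtain ⟨α, m, c, hcop, hα, hc⟩ := exists_isCoprime_norm_eq hus.symm
    have hα0 : α ≠ 0 := by
      rintro rfl
      rw [map_zero] at hc
      exact Units.ne_zero _ hc
    have hcop' : IsCoprime (2 * α.re) m := by
      refine isCoprime_of_prime_dvd ?_ fun p hp hpx hpm =>
        isCoprime_of_norm_eq h2 hd2 hcop hα hp hpm hpx
      rintro ⟨h0, rfl⟩
      have hre := (mul_eq_zero.mp h0).resolve_left two_ne_zero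
      rw [hre, isCoprime_zero_left] at hcop
      have hd0 : d = 0 := by
        have : d * (α.im * α.im) = 0 := by
          rw [norm_def, hre] at hα
          linear_combination -hα
        exact (mul_eq_zero.mp this).resolve_right (mul_ne_zero hcop.ne_zero hcop.ne_zero)
      exact (Fact.out : ∀ r : k, r ^ 2 ≠ algebraMap R k d + 0 * r) 0 (by simp [hd0])
    have hmem : unitsIncl k _ c * x ∈ idealSquares (QuadraticAlgebra R d 0)
        (QuadraticAlgebra k (algebraMap R k d) 0) :=
      (mem_idealSquares_iff hc).mpr ⟨_, span_pair_mul_self_of_norm hα hcop'⟩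
    have : unitsNorm k _ x = unitsNorm k _ (unitsIncl k _ c * x) * (c ^ 2)⁻¹ := by
      rw [map_mul, unitsNorm_unitsIncl, mul_comm (c ^ 2), mul_inv_cancel_right]
    rw [this]
    exact mul_mem (Subgroup.mem_sup_left ⟨_, hmem, rfl⟩)
      (inv_mem (Subgroup.mem_sup_right (sq_mem_squares _)))

/-- An ambiguous class number formula for `R[√d]` when `R` is a principal ideal domain. -/
theorem index_squares_mul_card [NeZero (2 : R)] (s : Finset R) (hs : ∀ p ∈ s, Prime p ∧ p ∣ d)
    (hs₁ : ∀ p ∈ s, ∀ q ∈ s, p ∣ q → p = q)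
    (hs₂ : ∀ p : R, Prime p → p ∣ d → ∃ q ∈ s, Associated p q)
    (h2 : ∀ p : R, Prime p → p ∣ 2 → p ∣ d) (hd2 : ∀ p : R, Prime p → ¬ p * p ∣ d) :
    (squares (QuadraticAlgebra R d 0)ˣ).index *
      Nat.card {x : ClassGroup (QuadraticAlgebra R d 0) // x ^ 2 = 1} * 2 =
    (squares Rˣ).index * 2 ^ s.card * (squares kˣ).relIndex
      ((unitsNorm k (algebraMap R k d)).range ⊓ (unitsSubgroup R k ⊔ squares kˣ)) := by
  set L := QuadraticAlgebra k (algebraMap R k d) 0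
  set S := idealSquares (QuadraticAlgebra R d 0) L
  set N := unitsNorm k (algebraMap R k d)
  set ι := unitsIncl k (algebraMap R k d)
  have : NeZero (2 : k) := ⟨by
    have := (map_ne_zero_iff _ (IsFractionRing.injective R k)).mpr (two_ne_zero (α := R))
    rwa [map_ofNat] at this⟩
  have hnsq := (Fact.out : ∀ r : k, r ^ 2 ≠ algebraMap R k d + 0 * r)
  have hdk : algebraMap R k d ≠ 0 := fun h => hnsq 0 (by simp [h])
  set g : kˣ := Units.mk0 _ hdk
  have hg : g ∉ squares kˣ := by
    rintro ⟨y, hy⟩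
    exact hnsq y (by simpa [g] using congrArg Units.val hy)
  have hC := comap_unitsIncl_idealSquares (k := k) (s := (s : Set R)) hs hs₂ h2 hd2
  rw [card_mul_index_squares (QuadraticAlgebra R d 0) L, ← map_norm_idealSquares h2 hd2,
    Subgroup.relIndex_sup_right, ← relIndex_primesSubgroup k s (fun p hp => (hs p hp).1) hs₁, ← hC]
  have hQS : squares Lˣ ≤ S ⊓ (squares kˣ).comap N :=
    le_inf squares_le_idealSquares (Subgroup.map_le_iff_le_comap.mp (map_squares_le _))
  have hS1 : S ⊓ (squares kˣ).comap N = (S.comap ι).map ι ⊔ squares Lˣ := by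
    apply le_antisymm
    · rintro x ⟨hxS, hxN⟩
      obtain ⟨c, y, rfl⟩ := exists_eq_incl_mul_sq_of_norm hxN
      refine mul_mem (Subgroup.mem_sup_left ⟨c, ?_, rfl⟩)
        (Subgroup.mem_sup_right (sq_mem_squares _))
      have := S.mul_mem hxS (S.inv_mem (squares_le_idealSquares (sq_mem_squares y)))
      rw [mul_inv_cancel_right] at this
      exact this
    · refine sup_le (le_inf (Subgroup.map_comap_le _ _) ?_) hQS
      rintro _ ⟨c, -, rfl⟩
      rw [Subgroup.mem_comap, unitsNorm_unitsIncl]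
      exact sq_mem_squares _
  have hcomapQ : (squares Lˣ).comap ι = squares kˣ ⊔ Subgroup.zpowers g := by
    ext c
    exact ⟨mem_squares_of_incl_mem_squares rfl, incl_mem_squares_of_mem rfl⟩
  have hA : (squares Lˣ).relIndex S = (squares Lˣ).relIndex (S ⊓ (squares kˣ).comap N) *
      (squares kˣ).relIndex (S.map N) := by
    rw [← Subgroup.relIndex_comap, ← Subgroup.inf_relIndex_right ((squares kˣ).comap N),
      inf_comm ((squares kˣ).comap N)]
    exact (Subgroup.relIndex_mul_relIndex _ _ _ hQS inf_le_left).symm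
  have hB : (squares kˣ).relIndex (S.comap ι) =
      2 * (squares Lˣ).relIndex (S ⊓ (squares kˣ).comap N) := by
    rw [hS1, Subgroup.relIndex_sup_right, ← Subgroup.relIndex_comap, hcomapQ,
      ← relIndex_sup_zpowers_eq_two le_rfl hg]
    refine (Subgroup.relIndex_mul_relIndex _ _ _ le_sup_left ?_).symm
    rw [← hcomapQ]
    exact Subgroup.comap_mono squares_le_idealSquares
  rw [hA, hB]
  ring

end SelmerCount

section SqrtTwo

/-- The ring `ℤ[√2]`. -/
abbrev ZSqrtTwo := QuadraticAlgebra ℤ 2 0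

/-- The field `ℚ(√2)`, as the base change of `ℤ[√2]` to `ℚ`. -/
abbrev QSqrtTwo := QuadraticAlgebra ℚ (algebraMap ℤ ℚ 2) 0

instance fact_sq_ne_two : Fact (∀ r : ℚ, r ^ 2 ≠ algebraMap ℤ ℚ 2 + 0 * r) := ⟨by
  intro r hr
  have h2 : ¬ IsSquare (2 : ℚ) := by
    rw [Rat.isSquare_iff]
    rintro ⟨⟨a, ha⟩, -⟩
    have ha' : a * a = 2 := by simpa using ha.symm
    have : a < 2 := by nlinarith
    have : -2 < a := by nlinarith
    interval_cases a <;> omega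
  exact h2 ⟨r, by simpa [sq] using hr.symm⟩⟩

instance : IsDomain ZSqrtTwo := isDomain_quadraticAlgebra ℚ 2

namespace ZSqrtTwo

lemma norm_eq (z : ZSqrtTwo) : norm z = z.re * z.re - 2 * (z.im * z.im) := by
  rw [norm_def]; ring

lemma norm_eq_zero_iff {z : ZSqrtTwo} : norm z = 0 ↔ z = 0 := by
  refine ⟨fun h => ?_, fun h => by rw [h]; simp⟩
  have h1 := algebraMap_norm_eq_mul_star z
  rw [h, map_zero, eq_comm, mul_eq_zero] at h1
  rcases h1 with h1 | h1
  · exact h1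
  · have hre := congrArg QuadraticAlgebra.re h1
    have him := congrArg QuadraticAlgebra.im h1
    simp at hre him
    ext <;> simp [hre, him]

/-- Division with remainder in `ℤ[√2]`, with explicit bounds on the coordinates of the remainder. -/
lemma exists_sub_mul_star_bound (x : ZSqrtTwo) {m : ZSqrtTwo} (hm : m ≠ 0) :
    ∃ q : ZSqrtTwo, 2 * |((x - q * m) * star m).re| ≤ |norm m| ∧
      2 * |((x - q * m) * star m).im| ≤ |norm m| := by
  have hN : norm m ≠ 0 := norm_eq_zero_iff.not.mpr hm
  have key : ∀ a : ℤ, ∃ q : ℤ, 2 * |a - q * norm m| ≤ |norm m| := by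
    intro a
    refine ⟨round ((a : ℚ) / (norm m : ℤ)), ?_⟩
    have h := abs_sub_round ((a : ℚ) / (norm m : ℤ))
    have hN' : (0 : ℚ) < |((norm m : ℤ) : ℚ)| := by simpa using hN
    have h1 : |(a : ℚ) - round ((a : ℚ) / (norm m : ℤ)) * (norm m : ℤ)| =
        |(a : ℚ) / (norm m : ℤ) - round ((a : ℚ) / (norm m : ℤ))| * |((norm m : ℤ) : ℚ)| := by
      rw [← abs_mul, sub_mul, div_mul_cancel₀ _ (by simpa using hN)]
    have h2 : 2 * |(a : ℚ) - round ((a : ℚ) / (norm m : ℤ)) * (norm m : ℤ)| ≤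
        |((norm m : ℤ) : ℚ)| := by
      rw [h1]; nlinarith
    exact_mod_cast h2
  obtain ⟨q₁, h₁⟩ := key (x * star m).re
  obtain ⟨q₂, h₂⟩ := key (x * star m).im
  refine ⟨⟨q₁, q₂⟩, ?_⟩
  have : (x - ⟨q₁, q₂⟩ * m) * star m = x * star m - ⟨q₁, q₂⟩ * algebraMap ℤ _ (norm m) := by
    rw [algebraMap_norm_eq_mul_star]; ring
  rw [this]
  constructor
  · rw [re_sub]
    simpa using h₁
  · rw [im_sub]
    simpa using h₂

lemma norm_mul_star_of_mul {x m : ZSqrtTwo} :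
    norm x * norm m =
      (x * star m).re * (x * star m).re - 2 * ((x * star m).im * (x * star m).im) := by
  rw [← norm_eq, map_mul, QuadraticAlgebra.norm_star]

lemma exists_sub_mul_norm_lt (x : ZSqrtTwo) {m : ZSqrtTwo} (hm : m ≠ 0) :
    ∃ q : ZSqrtTwo, |norm (x - q * m)| < |norm m| := by
  obtain ⟨q, h1, h2⟩ := exists_sub_mul_star_bound x hm
  refine ⟨q, ?_⟩
  have hN : 0 < |norm m| := abs_pos.mpr (norm_eq_zero_iff.not.mpr hm)
  have h3 := norm_mul_star_of_mul (x := x - q * m) (m := m)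
  set A := ((x - q * m) * star m).re
  set B := ((x - q * m) * star m).im
  have hA : 4 * (A * A) ≤ |norm m| * |norm m| := by
    rw [← abs_mul_abs_self A]; nlinarith [abs_nonneg A]
  have hB : 4 * (B * B) ≤ |norm m| * |norm m| := by
    rw [← abs_mul_abs_self B]; nlinarith [abs_nonneg B]
  have h4 : 2 * (|norm (x - q * m)| * |norm m|) ≤ |norm m| * |norm m| := by
    rw [← abs_mul, h3]
    rcases abs_cases (A * A - 2 * (B * B)) with ⟨h, -⟩ | ⟨h, -⟩ <;> rw [h] <;>
      nlinarith [mul_self_nonneg A, mul_self_nonneg B]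
  nlinarith [abs_nonneg (norm (x - q * m))]

instance : IsPrincipalIdealRing ZSqrtTwo := ⟨fun I => by
  classical
  by_cases hI : I = ⊥
  · exact hI ▸ bot_isPrincipal
  obtain ⟨m₀, hm₀, hm₀'⟩ := Submodule.exists_mem_ne_zero_of_ne_bot hI
  have hex : ∃ N : ℕ, ∃ m ∈ I, m ≠ 0 ∧ (norm m).natAbs = N := ⟨_, m₀, hm₀, hm₀', rfl⟩
  obtain ⟨m, hm, hm0, hmN⟩ := Nat.find_spec hex
  refine ⟨m, le_antisymm (fun x hx => ?_) ((Submodule.span_singleton_le_iff_mem _ _).mpr hm)⟩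
  obtain ⟨q, hq⟩ := exists_sub_mul_norm_lt x hm0
  have hmem : x - q * m ∈ I := sub_mem hx (I.mul_mem_left _ hm)
  have hlt : (norm (x - q * m)).natAbs < (norm m).natAbs := by
    rw [Int.abs_eq_natAbs, Int.abs_eq_natAbs] at hq
    exact_mod_cast hq
  have h0 : x - q * m = 0 := by
    by_contra h0
    exact Nat.find_min hex (hlt.trans_eq hmN) ⟨_, hmem, h0, rfl⟩
  rw [sub_eq_zero] at h0
  rw [h0]
  exact Submodule.smul_mem _ _ (Submodule.mem_span_singleton_self m)⟩

/-- The square root of two. -/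
def sqrtTwo : ZSqrtTwo := ⟨0, 1⟩

lemma sqrtTwo_mul_self : sqrtTwo * sqrtTwo = 2 := by
  ext <;> simp [sqrtTwo]

/-- The fundamental unit `1 + √2`. -/
def ε : ZSqrtTwoˣ where
  val := ⟨1, 1⟩
  inv := ⟨-1, 1⟩
  val_inv := by ext <;> simp
  inv_val := by ext <;> simp

@[simp] lemma re_ε : (ε : ZSqrtTwo).re = 1 := rfl
@[simp] lemma im_ε : (ε : ZSqrtTwo).im = 1 := rfl

lemma isUnit_iff_norm {z : ZSqrtTwo} : IsUnit z ↔ (norm z).natAbs = 1 := by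
  rw [isUnit_iff_norm_isUnit, Int.isUnit_iff_natAbs_eq]

lemma irreducible_of_norm_prime {z : ZSqrtTwo} (h : (norm z).natAbs.Prime) : Irreducible z := by
  refine ⟨fun hu => ?_, fun a b hab => ?_⟩
  · rw [isUnit_iff_norm.mp hu] at h
    exact Nat.not_prime_one h
  · rw [hab, map_mul, Int.natAbs_mul, Nat.prime_mul_iff] at h
    rw [isUnit_iff_norm, isUnit_iff_norm]
    tauto

lemma prime_sqrtTwo : Prime sqrtTwo := by
  rw [← irreducible_iff_prime]
  exact irreducible_of_norm_prime (by rw [norm_eq]; decide)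

/-- The ring homomorphism from `ℤ[√2]` sending `√2` to a given square root of `2`. -/
noncomputable def toRing {S : Type*} [CommRing S] {s : S} (hs : s * s = 2) : ZSqrtTwo →+* S where
  toFun z := z.re + z.im * s
  map_one' := by simp
  map_zero' := by simp
  map_add' z w := by push_cast [re_add, im_add]; ring
  map_mul' z w := by
    push_cast [re_mul, im_mul]
    linear_combination (- (z.im * w.im : S)) * hs

lemma toRing_apply {S : Type*} [CommRing S] {s : S} (hs : s * s = 2) (z : ZSqrtTwo) :
    toRing hs z = z.re + z.im * s := rfl

end ZSqrtTwo

end SqrtTwo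

section IntegralClosure

variable {R : Type*} [CommRing R] [IsDomain R] [IsPrincipalIdealRing R]
  {k : Type*} [Field k] [Algebra R k] [IsFractionRing R k] {d : R}
  [Fact (∀ r : k, r ^ 2 ≠ algebraMap R k d + 0 * r)]

instance isScalarTower_baseChange : IsScalarTower R (QuadraticAlgebra R d 0)
    (QuadraticAlgebra k (algebraMap R k d) 0) :=
  IsScalarTower.of_algebraMap_eq fun x => by
    ext
    · rfl
    · exact (map_zero (algebraMap R k)).symm

instance isScalarTower_baseChange_field : IsScalarTower R k
    (QuadraticAlgebra k (algebraMap R k d) 0) :=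
  IsScalarTower.of_algebraMap_eq fun x => by ext <;> rfl

lemma exists_algebraMap_re_norm {z : QuadraticAlgebra k (algebraMap R k d) 0}
    (hz : IsIntegral R z) :
    (∃ X, algebraMap R k X = 2 * z.re) ∧ ∃ N, algebraMap R k N = norm z := by
  let σ : QuadraticAlgebra k (algebraMap R k d) 0 →ₐ[R] QuadraticAlgebra k (algebraMap R k d) 0 :=
    { starRingEnd (QuadraticAlgebra k (algebraMap R k d) 0) with
      commutes' := fun r => by
        change star (algebraMap R (QuadraticAlgebra k (algebraMap R k d) 0) r) = _
        rw [IsScalarTower.algebraMap_apply R k (QuadraticAlgebra k (algebraMap R k d) 0)]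
        ext <;> simp }
  have hσ : IsIntegral R (star z) := hz.map σ
  have key : ∀ c : k, IsIntegral R (algebraMap k (QuadraticAlgebra k (algebraMap R k d) 0) c) →
      ∃ a, algebraMap R k a = c := fun c hc =>
    IsIntegrallyClosed.isIntegral_iff.mp ((isIntegral_algebraMap_iff
      (algebraMap k (QuadraticAlgebra k (algebraMap R k d) 0)).injective).mp hc)
  constructor
  · refine key _ ?_
    have : algebraMap k (QuadraticAlgebra k (algebraMap R k d) 0) (2 * z.re) = z + star z := by
      ext <;> simp; ring
    rw [this]
    exact hz.add hσ
  · refine key _ ?_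
    rw [algebraMap_norm_eq_mul_star]
    exact hz.mul hσ

omit [IsPrincipalIdealRing R] in
lemma dvd_of_sq_sub_eq {π d' : R} (hπ : Prime π) (hd' : ¬ π ∣ d') {X Y N : R}
    (h : X ^ 2 - π * d' * Y ^ 2 = π ^ 2 * N) : π ∣ X ∧ π ∣ Y := by
  have h1 : π ∣ X := hπ.dvd_of_dvd_pow (n := 2) ⟨d' * Y ^ 2 + π * N, by linear_combination h⟩
  refine ⟨h1, ?_⟩
  obtain ⟨X', rfl⟩ := h1
  have h2 : d' * Y ^ 2 = π * (X' ^ 2 - N) := by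
    apply mul_left_cancel₀ hπ.ne_zero
    linear_combination -h
  exact hπ.dvd_of_dvd_pow ((hπ.dvd_or_dvd ⟨_, h2⟩).resolve_left hd')

variable [NeZero (2 : R)]

lemma isIntegralClosure_baseChange (hd : Squarefree d) {π d' : R} (hπ : Prime π)
    (hπ2 : π * π = 2) (hdd' : d = π * d') :
    IsIntegralClosure (QuadraticAlgebra R d 0) R (QuadraticAlgebra k (algebraMap R k d) 0) where
  algebraMap_injective := injective_algebraMap_baseChange
  isIntegral_iff := by
    intro z
    constructor
    swap
    · rintro ⟨y, rfl⟩
      exact (IsIntegral.of_finite R y).algebraMap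
    intro hz
    have hinj := IsFractionRing.injective R k
    obtain ⟨⟨X, hX⟩, N, hN⟩ := exists_algebraMap_re_norm hz
    have hd0 : algebraMap R k d ≠ 0 := by simpa using hd.ne_zero
    have h2 : (2 : k) ≠ 0 := by
      have := (map_ne_zero_iff _ hinj).mpr (two_ne_zero (α := R))
      rwa [map_ofNat] at this
    have hN' : algebraMap R k N = z.re ^ 2 - algebraMap R k d * z.im ^ 2 := by
      rw [hN, norm_def]; ring
    have hW : ∃ W, algebraMap R k W = 2 * algebraMap R k d * z.im := by
      refine IsIntegrallyClosed.exists_algebraMap_eq_of_isIntegral_pow (n := 2) two_pos ?_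
      have : (2 * algebraMap R k d * z.im) ^ 2 = algebraMap R k (d * (X ^ 2 - 4 * N)) := by
        simp only [map_mul, map_sub, map_pow, hN', hX, map_ofNat]
        ring
      rw [this]
      exact isIntegral_algebraMap
    obtain ⟨W, hW⟩ := hW
    have hW2 : W ^ 2 = d * (X ^ 2 - 4 * N) := by
      apply hinj
      simp only [map_mul, map_sub, map_pow, hN', hX, map_ofNat, hW]
      ring
    obtain ⟨Y, rfl⟩ := (hd.dvd_pow_iff_dvd two_ne_zero).mp ⟨_, hW2⟩
    have hY : algebraMap R k Y = 2 * z.im := by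
      apply mul_left_cancel₀ hd0
      rw [← map_mul, hW]; ring
    have h4 : X ^ 2 - π * d' * Y ^ 2 = π ^ 2 * (π ^ 2 * N) := by
      apply mul_left_cancel₀ hd.ne_zero
      rw [← hdd']
      linear_combination -hW2 - d * N * (2 + π * π) * hπ2
    have hd'' : ¬ π ∣ d' := by
      rintro ⟨e, rfl⟩
      exact hπ.not_isUnit (hd π ⟨e, by rw [hdd']; ring⟩)
    obtain ⟨⟨X, rfl⟩, ⟨Y, rfl⟩⟩ := dvd_of_sq_sub_eq hπ hd'' h4
    have h5 : X ^ 2 - π * d' * Y ^ 2 = π ^ 2 * N := by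
      apply mul_left_cancel₀ (pow_ne_zero 2 hπ.ne_zero)
      linear_combination h4
    obtain ⟨⟨X, rfl⟩, ⟨Y, rfl⟩⟩ := dvd_of_sq_sub_eq hπ hd'' h5
    refine ⟨⟨X, Y⟩, ?_⟩
    have h22 : (algebraMap R k π) * algebraMap R k π = 2 := by
      rw [← map_mul, hπ2, map_ofNat]
    simp only [map_mul] at hX hY
    ext
    · apply mul_left_cancel₀ h2
      rw [re_algebraMap_baseChange, ← hX, ← h22]; ring
    · apply mul_left_cancel₀ h2
      rw [im_algebraMap_baseChange, ← hY, ← h22]; ring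

end IntegralClosure

section TotallyReal

open NumberField NumberField.Units

variable {K : Type*} [Field K] [NumberField K]

lemma torsion_le_zpowers_neg_one (φ : K →+* ℝ) : torsion K ≤ Subgroup.zpowers (-1) := by
  intro ζ hζ
  obtain ⟨n, hn, h⟩ := isOfFinOrder_iff_pow_eq_one.mp (show IsOfFinOrder ζ from hζ)
  have h1 : φ (ζ : K) ^ n = 1 := by
    rw [← map_pow, ← coe_pow, h, coe_one, map_one]
  have h2 : ζ = 1 ∨ ζ = -1 := by
    rcases (pow_eq_one_iff_cases).mp h1 with h | h | h
    · omega
    · left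
      apply coe_injective K
      apply φ.injective
      simpa using h
    · right
      apply coe_injective K
      apply φ.injective
      simpa using h.1
  rcases h2 with rfl | rfl
  · exact one_mem _
  · exact Subgroup.mem_zpowers _

lemma neg_one_notMem_squares (φ : K →+* ℝ) : (-1 : (𝓞 K)ˣ) ∉ squares (𝓞 K)ˣ := by
  rintro ⟨y, hy⟩
  have h : φ (y : K) ^ 2 = -1 := by
    rw [← map_pow, ← coe_pow]
    have : y ^ 2 = -1 := hy
    rw [this, coe_neg_one, map_neg, map_one]
  nlinarith [sq_nonneg (φ (y : K))]

variable (K) in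
/-- Dirichlet's unit theorem, in terms of a fundamental system of units. -/
noncomputable def unitsEquiv : torsion K × Multiplicative (Fin (rank K) → ℤ) ≃* (𝓞 K)ˣ :=
  MulEquiv.ofBijective
    ({  toFun := fun x => x.1 * ∏ i, fundSystem K i ^ (x.2.toAdd i)
        map_one' := by simp
        map_mul' := fun x y => by
          simp only [Prod.fst_mul, Prod.snd_mul, toAdd_mul, Pi.add_apply, zpow_add,
            Finset.prod_mul_distrib, Subgroup.coe_mul]
          rw [mul_mul_mul_comm] } : torsion K × Multiplicative (Fin (rank K) → ℤ) →* (𝓞 K)ˣ)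
    (Function.bijective_iff_existsUnique _ |>.mpr fun u => by
      obtain ⟨x, hx, hx'⟩ := exist_unique_eq_mul_prod K u
      exact ⟨(x.1, Multiplicative.ofAdd x.2), hx.symm, fun y hy =>
        congrArg (fun z : _ × _ => (z.1, Multiplicative.ofAdd z.2))
          (hx' (y.1, y.2.toAdd) hy.symm)⟩)

variable (K) in
/-- The exponents of a unit with respect to a fundamental system, modulo two. -/
noncomputable def exponentsModTwo : (𝓞 K)ˣ →* Multiplicative (Fin (rank K) → ZMod 2) where
  toFun u := Multiplicative.ofAdd fun i => (((unitsEquiv K).symm u).2.toAdd i : ZMod 2)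
  map_one' := by
    rw [map_one]
    apply Multiplicative.toAdd.injective
    funext i
    simp
  map_mul' u v := by
    rw [map_mul]
    apply Multiplicative.toAdd.injective
    funext i
    simp

lemma toAdd_exponentsModTwo (u : (𝓞 K)ˣ) (i : Fin (rank K)) :
    (exponentsModTwo K u).toAdd i = (((unitsEquiv K).symm u).2.toAdd i : ZMod 2) := rfl

lemma exponentsModTwo_surjective : Function.Surjective (exponentsModTwo K) := by
  intro e
  refine ⟨unitsEquiv K (1, Multiplicative.ofAdd fun i => ((e.toAdd i).val : ℤ)), ?_⟩
  apply Multiplicative.toAdd.injective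
  funext i
  rw [toAdd_exponentsModTwo, MulEquiv.symm_apply_apply]
  simp

lemma ker_exponentsModTwo : (exponentsModTwo K).ker = squares (𝓞 K)ˣ ⊔ torsion K := by
  apply le_antisymm
  · intro u hu
    obtain ⟨⟨ζ, e⟩, rfl⟩ := (unitsEquiv K).surjective u
    have hu' : ∀ i, (2 : ℤ) ∣ e.toAdd i := by
      intro i
      have := congrFun (congrArg Multiplicative.toAdd hu) i
      rw [toAdd_exponentsModTwo, MulEquiv.symm_apply_apply] at this
      exact (ZMod.intCast_zmod_eq_zero_iff_dvd _ 2).mp this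
    choose e' he using hu'
    have : (ζ, e) = (1, Multiplicative.ofAdd e') ^ 2 * (ζ, 1) := by
      ext1
      · simp
      · apply Multiplicative.toAdd.injective
        funext i
        simp [he]
    rw [this, map_mul, map_pow]
    refine mul_mem (Subgroup.mem_sup_left (sq_mem_squares _)) (Subgroup.mem_sup_right ?_)
    have : unitsEquiv K (ζ, 1) = ζ := by
      change (ζ : (𝓞 K)ˣ) * ∏ i, fundSystem K i ^ (0 : ℤ) = ζ
      simp
    rw [this]
    exact ζ.2
  · refine sup_le ?_ ?_
    · rintro _ ⟨y, rfl⟩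
      rw [MonoidHom.mem_ker, powMonoidHom_apply, map_pow]
      apply Multiplicative.toAdd.injective
      funext i
      rw [toAdd_pow, Pi.smul_apply, toAdd_one, Pi.zero_apply, two_nsmul]
      exact CharTwo.add_self_eq_zero _
    · intro u hu
      have : unitsEquiv K (⟨u, hu⟩, 1) = u := by
        change u * ∏ i, fundSystem K i ^ (0 : ℤ) = u
        simp
      rw [MonoidHom.mem_ker, ← this]
      apply Multiplicative.toAdd.injective
      funext i
      rw [toAdd_exponentsModTwo, MulEquiv.symm_apply_apply]
      simp

theorem index_squares_units [IsTotallyReal K] (φ : K →+* ℝ) :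
    (squares (𝓞 K)ˣ).index = 2 ^ Module.finrank ℚ K := by
  have h1 : squares (𝓞 K)ˣ ⊔ torsion K = squares (𝓞 K)ˣ ⊔ Subgroup.zpowers (-1) := by
    refine le_antisymm (sup_le_sup_left (torsion_le_zpowers_neg_one φ) _)
      (sup_le_sup_left ?_ _)
    rw [Subgroup.zpowers_le, torsion, CommGroup.mem_torsion]
    exact isOfFinOrder_iff_pow_eq_one.mpr ⟨2, two_pos, by simp⟩
  have h2 : (squares (𝓞 K)ˣ ⊔ torsion K).index = 2 ^ rank K := by
    rw [← ker_exponentsModTwo, Subgroup.index_ker,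
      MonoidHom.range_eq_top.mpr exponentsModTwo_surjective, Subgroup.card_top]
    simp
  have h3 := relIndex_sup_zpowers_eq_two le_rfl (neg_one_notMem_squares φ)
  rw [← Subgroup.relIndex_mul_index (le_sup_left : squares (𝓞 K)ˣ ≤ _ ⊔ torsion K), h2, h1, h3,
    ← pow_succ']
  congr 1
  have h4 := InfinitePlace.card_eq_nrRealPlaces_add_nrComplexPlaces (K := K)
  rw [IsTotallyReal.nrComplexPlaces_eq_zero, ← IsTotallyReal.finrank] at h4
  have := Module.finrank_pos (R := ℚ) (M := K)
  rw [rank]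
  omega

end TotallyReal

section Embedding

open NumberField

/-- The ring homomorphism from `k[√a]` extending a given one on `k` and sending `√a` to a given
element. -/
def liftHom {k S : Type*} [CommRing k] [CommRing S] {a : k} (φ : k →+* S) (s : S)
    (hs : s * s = φ a) : QuadraticAlgebra k a 0 →+* S where
  toFun z := φ z.re + φ z.im * s
  map_one' := by simp
  map_zero' := by simp
  map_add' z w := by simp only [re_add, im_add, map_add]; ring
  map_mul' z w := by
    simp only [re_mul, im_mul, map_add, map_mul, map_zero]
    linear_combination (- (φ z.im * φ w.im)) * hs

lemma liftHom_apply {k S : Type*} [CommRing k] [CommRing S] {a : k} (φ : k →+* S) (s : S)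
    (hs : s * s = φ a) (z : QuadraticAlgebra k a 0) :
    liftHom φ s hs z = φ z.re + φ z.im * s := rfl

lemma apply_omega_mul_self {k S : Type*} [CommRing k] [CommRing S] {a : k}
    (φ : QuadraticAlgebra k a 0 →+* S) : φ ω * φ ω = φ (algebraMap k _ a) := by
  rw [← map_mul]
  congr 1
  ext <;> simp

lemma star_apply_eq_self {k : Type*} [CommRing k] {a : k} (φ : QuadraticAlgebra k a 0 →+* ℂ)
    (h : ∀ x : k, star (φ (algebraMap k _ x)) = φ (algebraMap k _ x))
    (ha : 0 ≤ (φ (algebraMap k _ a)).re) (z : QuadraticAlgebra k a 0) : star (φ z) = φ z := by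
  have hω : star (φ ω) = φ ω := by
    have h1 := apply_omega_mul_self φ
    have h2 := congrArg Complex.im (h a)
    have hre := congrArg Complex.re h1
    have him := congrArg Complex.im h1
    simp only [Complex.star_def, Complex.conj_im, Complex.mul_re, Complex.mul_im] at h2 hre him
    have h3 : (φ ω).im = 0 := by
      have h4 : (φ ω).re * (φ ω).im = 0 := by linarith
      rcases mul_eq_zero.mp h4 with h5 | h5
      · rw [h5] at hre
        nlinarith
      · exact h5
    exact Complex.conj_eq_iff_im.mpr h3
  have hz : z = algebraMap k _ z.re + algebraMap k _ z.im * ω := by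
    ext <;> simp
  rw [hz, map_add, map_mul, star_add, star_mul', h, h, hω]

instance : NumberField QSqrtTwo := NumberField.of_module_finite ℚ QSqrtTwo

lemma finrank_QSqrtTwo : Module.finrank ℚ QSqrtTwo = 2 := by
  rw [← QuadraticAlgebra.finrank_eq_two (R := ℚ) (algebraMap ℤ ℚ 2) 0]

lemma star_apply_QSqrtTwo (φ : QSqrtTwo →+* ℂ) (z : QSqrtTwo) : star (φ z) = φ z := by
  refine star_apply_eq_self φ (fun x => ?_) ?_ z
  · change star ((φ.comp (algebraMap ℚ _)) x) = (φ.comp (algebraMap ℚ _)) x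
    rw [eq_ratCast]
    simp
  · change 0 ≤ ((φ.comp (algebraMap ℚ _)) _).re
    rw [eq_ratCast]
    simp

instance : IsTotallyReal QSqrtTwo where
  isReal v := by
    rw [InfinitePlace.isReal_iff]
    ext z
    exact star_apply_QSqrtTwo _ z

/-- The embedding of `ℚ(√2)` into `ℝ`. -/
noncomputable def realEmbedding : QSqrtTwo →+* ℝ :=
  liftHom (algebraMap ℚ ℝ) (Real.sqrt 2) (by simp)

/-- The element `n (2 + √2)`. -/
def radicand (n : ℕ) : ZSqrtTwo := ⟨2 * n, n⟩

@[simp] lemma re_radicand (n : ℕ) : (radicand n).re = 2 * n := rfl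
@[simp] lemma im_radicand (n : ℕ) : (radicand n).im = n := rfl

variable (n : ℕ) [NeZero n]

instance fact_sq_ne_radicand : Fact (∀ r : QSqrtTwo,
    r ^ 2 ≠ algebraMap ZSqrtTwo QSqrtTwo (radicand n) + 0 * r) := ⟨by
  intro r hr
  have hn : (n : ℚ) ≠ 0 := NeZero.ne _
  rw [zero_mul, add_zero] at hr
  have h1 := congrArg QuadraticAlgebra.norm hr
  rw [map_pow, norm_algebraMap_baseChange, ZSqrtTwo.norm_eq] at h1
  refine fact_sq_ne_two.out (QuadraticAlgebra.norm r / n) ?_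
  rw [div_pow, h1, div_eq_iff (pow_ne_zero 2 hn)]
  simp
  ring⟩

/-- The field `ℚ(√(n (2 + √2)))`. -/
abbrev QuarticField : Type :=
  QuadraticAlgebra QSqrtTwo (algebraMap ZSqrtTwo QSqrtTwo (radicand n)) 0

instance : NumberField (QuarticField n) := NumberField.of_module_finite QSqrtTwo _

omit [NeZero n] in
lemma finrank_quarticField : Module.finrank ℚ (QuarticField n) = 4 := by
  have h := Module.finrank_mul_finrank ℚ QSqrtTwo (QuarticField n)
  rw [QuadraticAlgebra.finrank_eq_two (R := QSqrtTwo),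
    QuadraticAlgebra.finrank_eq_two (R := ℚ)] at h
  exact h.symm

instance : IsTotallyReal (QuarticField n) where
  isReal v := by
    rw [InfinitePlace.isReal_iff]
    ext z
    have h : ∀ x : QSqrtTwo, star (v.embedding (algebraMap QSqrtTwo _ x)) =
        v.embedding (algebraMap QSqrtTwo _ x) := fun x =>
      star_apply_QSqrtTwo (v.embedding.comp (algebraMap QSqrtTwo _)) x
    refine star_apply_eq_self _ h ?_ z
    set φ := v.embedding.comp (algebraMap QSqrtTwo (QuarticField n))
    change 0 ≤ (φ (algebraMap ZSqrtTwo QSqrtTwo (radicand n))).re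
    have h1 : algebraMap ZSqrtTwo QSqrtTwo (radicand n) = n * (2 + (ω : QSqrtTwo)) := by
      ext <;> simp [mul_comm]
    have h3 : algebraMap ℚ QSqrtTwo (algebraMap ℤ ℚ 2) = 2 := by ext <;> simp
    have h2 : φ ω * φ ω = 2 :=
      (apply_omega_mul_self φ).trans ((congrArg φ h3).trans (map_ofNat φ 2))
    have h4 := Complex.conj_eq_iff_im.mp (star_apply_QSqrtTwo φ ω)
    have h5 := congrArg Complex.re h2
    rw [Complex.mul_re, h4] at h5
    norm_num at h5
    rw [h1]
    simp only [map_mul, map_add, map_natCast, map_ofNat, Complex.mul_re, Complex.natCast_im]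
    norm_num
    have : -2 ≤ (φ ω).re := by nlinarith
    exact mul_nonneg (Nat.cast_nonneg n) (by linarith)

lemma isIntegralClosure_quarticField (hd : Squarefree (radicand n)) :
    IsIntegralClosure (QuadraticAlgebra ZSqrtTwo (radicand n) 0) ZSqrtTwo (QuarticField n) :=
  isIntegralClosure_baseChange hd (π := ZSqrtTwo.sqrtTwo) (d' := n * (ZSqrtTwo.ε : ZSqrtTwo))
    ZSqrtTwo.prime_sqrtTwo ZSqrtTwo.sqrtTwo_mul_self (by
      ext <;> simp [ZSqrtTwo.sqrtTwo])

/-- The ring of integers of `ℚ(√2)`. -/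
noncomputable def ringOfIntegersEquiv : 𝓞 QSqrtTwo ≃+* ZSqrtTwo := by
  have : IsIntegralClosure ZSqrtTwo ℤ QSqrtTwo :=
    IsIntegralClosure.of_isIntegrallyClosed _ _ _
  exact RingOfIntegers.equiv ZSqrtTwo

lemma isDedekindDomain_quadraticAlgebra (hd : Squarefree (radicand n)) :
    IsDedekindDomain (QuadraticAlgebra ZSqrtTwo (radicand n) 0) := by
  have := isIntegralClosure_quarticField n hd
  have := isDomain_quadraticAlgebra QSqrtTwo (radicand n)
  exact IsIntegralClosure.isDedekindDomain ZSqrtTwo QSqrtTwo (QuarticField n) _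

/-- The ring of integers of `ℚ(√(n (2 + √2)))`. -/
noncomputable def ringOfIntegersQuarticEquiv (hd : Squarefree (radicand n)) :
    𝓞 (QuarticField n) ≃+* QuadraticAlgebra ZSqrtTwo (radicand n) 0 := by
  have := isIntegralClosure_quarticField n hd
  have : IsIntegralClosure (QuadraticAlgebra ZSqrtTwo (radicand n) 0) ℤ (QuarticField n) :=
    { algebraMap_injective := injective_algebraMap_baseChange
      isIntegral_iff := fun {x} => by
        rw [← IsIntegralClosure.isIntegral_iff (R := ZSqrtTwo)
          (A := QuadraticAlgebra ZSqrtTwo (radicand n) 0)]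
        exact ⟨fun h => h.tower_top, fun h => isIntegral_trans x h⟩ }
  exact RingOfIntegers.equiv _

lemma index_squares_of_mulEquiv {G H : Type*} [CommGroup G] [CommGroup H] (e : G ≃* H) :
    (squares G).index = (squares H).index := by
  have : squares G = (squares H).comap (e : G →* H) := by
    ext x
    constructor
    · rintro ⟨y, rfl⟩
      exact ⟨e y, by simp⟩
    · rintro ⟨y, hy⟩
      refine ⟨e.symm y, e.injective ?_⟩
      simpa using hy
  rw [this, Subgroup.index_comap_of_surjective _ e.surjective]

lemma index_squares_ZSqrtTwo : (squares ZSqrtTwoˣ).index = 4 := by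
  rw [← index_squares_of_mulEquiv (Units.mapEquiv ringOfIntegersEquiv.toMulEquiv),
    index_squares_units realEmbedding, finrank_QSqrtTwo]
  norm_num

/-- The embedding of `ℚ(√(n (2 + √2)))` into `ℝ`. -/
noncomputable def quarticEmbedding : QuarticField n →+* ℝ :=
  liftHom realEmbedding (Real.sqrt ((n : ℝ) * ((1 : ℝ) + Real.sqrt 2) * Real.sqrt 2)) (by
    rw [Real.mul_self_sqrt (by positivity)]
    have : (Real.sqrt 2) * Real.sqrt 2 = 2 := by simp
    simp [realEmbedding, liftHom_apply]
    linear_combination n * this)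

lemma index_squares_quartic (hd : Squarefree (radicand n)) :
    (squares (QuadraticAlgebra ZSqrtTwo (radicand n) 0)ˣ).index = 16 := by
  rw [← index_squares_of_mulEquiv (Units.mapEquiv (ringOfIntegersQuarticEquiv n hd).toMulEquiv),
    index_squares_units (quarticEmbedding n), finrank_quarticField]
  norm_num

omit [NeZero n] in
lemma quarticEmbedding_apply (z : QuarticField n) :
    quarticEmbedding n z = z.re.re + z.re.im * Real.sqrt 2 + (z.im.re + z.im.im * Real.sqrt 2) *
      Real.sqrt ((n : ℝ) * ((1 : ℝ) + Real.sqrt 2) * Real.sqrt 2) := by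
  simp [quarticEmbedding, realEmbedding, liftHom_apply]

lemma fieldRange_quarticEmbedding : (quarticEmbedding n).toRatAlgHom.fieldRange =
    IntermediateField.adjoin ℚ
      ({Real.sqrt ((n : ℝ) * ((1 : ℝ) + Real.sqrt 2) * Real.sqrt 2)} : Set ℝ) := by
  apply le_antisymm
  · rintro _ ⟨z, rfl⟩
    change quarticEmbedding n z ∈ _
    rw [quarticEmbedding_apply]
    set t := Real.sqrt ((n : ℝ) * ((1 : ℝ) + Real.sqrt 2) * Real.sqrt 2)
    have ht : t ∈ IntermediateField.adjoin ℚ ({t} : Set ℝ) :=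
      IntermediateField.mem_adjoin_simple_self ℚ t
    have hq : ∀ q : ℚ, (q : ℝ) ∈ IntermediateField.adjoin ℚ ({t} : Set ℝ) := fun q =>
      IntermediateField.algebraMap_mem _ q
    have h2 : Real.sqrt 2 ∈ IntermediateField.adjoin ℚ ({t} : Set ℝ) := by
      have hn : (n : ℝ) ≠ 0 := NeZero.ne _
      have : Real.sqrt 2 = t ^ 2 / (n : ℚ) - (2 : ℚ) := by
        rw [Real.sq_sqrt (by positivity)]
        have h22 : (Real.sqrt 2) * Real.sqrt 2 = 2 := by simp
        push_cast
        field_simp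
        linear_combination - h22
      rw [this]
      exact sub_mem (div_mem (pow_mem ht 2) (hq _)) (hq _)
    exact add_mem (add_mem (hq _) (mul_mem (hq _) h2))
      (mul_mem (add_mem (hq _) (mul_mem (hq _) h2)) ht)
  · rw [IntermediateField.adjoin_simple_le_iff]
    refine ⟨(ω : QuarticField n), ?_⟩
    change quarticEmbedding n ω = _
    rw [quarticEmbedding_apply]
    simp

lemma twoTorsCard_eq (hd : Squarefree (radicand n)) {K : IntermediateField ℚ ℝ}
    (hK : K = IntermediateField.adjoin ℚ
      ({Real.sqrt ((n : ℝ) * ((1 : ℝ) + Real.sqrt 2) * Real.sqrt 2)} : Set ℝ))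
    [IsDomain (QuadraticAlgebra ZSqrtTwo (radicand n) 0)] :
    twoTorsCard K =
      Nat.card {x : ClassGroup (QuadraticAlgebra ZSqrtTwo (radicand n) 0) // x ^ 2 = 1} := by
  rw [← fieldRange_quarticEmbedding] at hK
  subst hK
  let e₁ : QuarticField n ≃+* (quarticEmbedding n).toRatAlgHom.fieldRange :=
    (AlgEquiv.ofInjectiveField (quarticEmbedding n).toRatAlgHom).toRingEquiv
  let e := ClassGroup.mulEquiv ((RingOfIntegers.mapRingEquiv e₁).symm.trans
    (ringOfIntegersQuarticEquiv n hd))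
  exact Nat.card_congr (e.toEquiv.subtypeEquiv fun x => by
    change x ^ 2 = 1 ↔ e x ^ 2 = 1
    rw [← map_pow, map_eq_one_iff e e.injective])

lemma eight_mul_twoTorsCard (hd : Squarefree (radicand n)) {K : IntermediateField ℚ ℝ}
    (hK : K = IntermediateField.adjoin ℚ
      ({Real.sqrt ((n : ℝ) * ((1 : ℝ) + Real.sqrt 2) * Real.sqrt 2)} : Set ℝ))
    (s : Finset ZSqrtTwo) (hs : ∀ p ∈ s, Prime p ∧ p ∣ radicand n)
    (hs₁ : ∀ p ∈ s, ∀ q ∈ s, p ∣ q → p = q)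
    (hs₂ : ∀ p, Prime p → p ∣ radicand n → ∃ q ∈ s, Associated p q) :
    8 * twoTorsCard K = 2 ^ s.card * (squares QSqrtTwoˣ).relIndex
      ((unitsNorm QSqrtTwo (algebraMap ZSqrtTwo QSqrtTwo (radicand n))).range ⊓
        (unitsSubgroup ZSqrtTwo QSqrtTwo ⊔ squares QSqrtTwoˣ)) := by
  have := isDedekindDomain_quadraticAlgebra n hd
  have h := index_squares_mul_card (k := QSqrtTwo) (d := radicand n) s hs hs₁ hs₂
    (fun p hp h2 => by
      rw [← ZSqrtTwo.sqrtTwo_mul_self] at h2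
      have h3 : p ∣ ZSqrtTwo.sqrtTwo := (hp.dvd_or_dvd h2).elim id id
      refine h3.trans ⟨n * (ZSqrtTwo.ε : ZSqrtTwo), ?_⟩
      ext <;> simp [ZSqrtTwo.sqrtTwo])
    (fun p hp h => hp.not_isUnit (hd p h))
  rw [index_squares_quartic n hd, index_squares_ZSqrtTwo] at h
  rw [twoTorsCard_eq n hd hK]
  linarith

end Embedding

section Units

namespace ZSqrtTwo

/-- The norm of a unit, as a unit of `ℤ`. -/
noncomputable def normUnits : ZSqrtTwoˣ →* ℤˣ := Units.map (norm : ZSqrtTwo →* ℤ)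

lemma coe_normUnits (u : ZSqrtTwoˣ) : (normUnits u : ℤ) = QuadraticAlgebra.norm (u : ZSqrtTwo) :=
  rfl

lemma normUnits_neg_one : normUnits (-1) = 1 := by
  ext; rw [coe_normUnits, norm_eq]; simp

lemma normUnits_ε : normUnits ε = -1 := by
  ext; rw [coe_normUnits, norm_eq]; simp

lemma neg_one_notMem_squares : (-1 : ZSqrtTwoˣ) ∉ squares ZSqrtTwoˣ := by
  rintro ⟨y, hy⟩
  have h := congrArg (fun u : ZSqrtTwoˣ => (u : ZSqrtTwo).re) hy
  simp [sq] at h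
  nlinarith [sq_nonneg (y : ZSqrtTwo).re, sq_nonneg (y : ZSqrtTwo).im]

lemma ε_notMem : ε ∉ squares ZSqrtTwoˣ ⊔ Subgroup.zpowers (-1) := by
  intro h
  have hle : squares ZSqrtTwoˣ ⊔ Subgroup.zpowers (-1) ≤ normUnits.ker := by
    refine sup_le ?_ ((Subgroup.zpowers_le).mpr normUnits_neg_one)
    rintro _ ⟨y, rfl⟩
    rw [MonoidHom.mem_ker, powMonoidHom_apply, map_pow, Int.units_sq]
  have := hle h
  rw [MonoidHom.mem_ker, normUnits_ε] at this
  exact absurd this (by decide)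

lemma sup_eq_top :
    squares ZSqrtTwoˣ ⊔ Subgroup.zpowers (-1) ⊔ Subgroup.zpowers ε = ⊤ := by
  have h1 := relIndex_sup_zpowers_eq_two le_rfl neg_one_notMem_squares
  have h2 := relIndex_sup_zpowers_eq_two le_sup_left ε_notMem
  have h3 := Subgroup.relIndex_mul_relIndex (squares ZSqrtTwoˣ)
    (squares ZSqrtTwoˣ ⊔ Subgroup.zpowers (-1)) _ le_sup_left
    (le_sup_left (b := Subgroup.zpowers ε))
  rw [h1, h2] at h3
  have h4 := Subgroup.relIndex_mul_index (H := squares ZSqrtTwoˣ)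
    (K := squares ZSqrtTwoˣ ⊔ Subgroup.zpowers (-1) ⊔ Subgroup.zpowers ε)
    (le_sup_left.trans le_sup_left)
  rw [← h3, index_squares_ZSqrtTwo] at h4
  exact Subgroup.index_eq_one.mp (by omega)

lemma exists_eq_mul_sq (u : ZSqrtTwoˣ) :
    ∃ y, u = y ^ 2 ∨ u = -1 * y ^ 2 ∨ u = ε * y ^ 2 ∨ u = -ε * y ^ 2 := by
  have key : ∀ (H : Subgroup ZSqrtTwoˣ) (g u : ZSqrtTwoˣ), u ∈ H ⊔ Subgroup.zpowers g →
      ∃ h ∈ H, ∃ y, u = h * y ^ 2 ∨ u = g * h * y ^ 2 := by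
    intro H g u hu
    obtain ⟨h, hh, z, hz, rfl⟩ := Subgroup.mem_sup.mp hu
    obtain ⟨m, rfl⟩ := Subgroup.mem_zpowers_iff.mp hz
    refine ⟨h, hh, ?_⟩
    obtain ⟨j, rfl | rfl⟩ := Int.even_or_odd' m
    · exact ⟨g ^ j, Or.inl (by rw [mul_comm 2 j, zpow_mul]; rfl)⟩
    · refine ⟨g ^ j, Or.inr ?_⟩
      rw [zpow_add, mul_comm 2 j, zpow_mul, zpow_one, mul_comm g h, mul_assoc, mul_comm g]
      rfl
  obtain ⟨h, hh, y, hy⟩ := key _ _ u (sup_eq_top ▸ Subgroup.mem_top u)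
  obtain ⟨_, ⟨h, rfl⟩, z, hz⟩ := key _ _ _ hh
  simp only [powMonoidHom_apply] at hz
  refine ⟨h * z * y, ?_⟩
  rcases hz with rfl | rfl <;> rcases hy with rfl | rfl
  · left; simp only [mul_pow]
  · right; right; left; simp only [mul_pow, mul_assoc]
  · right; left; simp only [mul_pow, mul_assoc]
  · right; right; right; simp only [mul_pow, mul_assoc, neg_mul, one_mul, mul_neg]

end ZSqrtTwo

end Units

section NormUnits

variable (n : ℕ) [NeZero n]

/-- The unit `u` is a norm from `ℚ(√(n (2 + √2)))`. -/
def IsNormUnit (u : ZSqrtTwoˣ) : Prop :=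
  Units.map (algebraMap ZSqrtTwo QSqrtTwo : ZSqrtTwo →* QSqrtTwo) u ∈
    (unitsNorm QSqrtTwo (algebraMap ZSqrtTwo QSqrtTwo (radicand n))).range

/-- The index of the squares in the group of units and squares which are norms. -/
noncomputable def normIndex : ℕ := (squares QSqrtTwoˣ).relIndex
  ((unitsNorm QSqrtTwo (algebraMap ZSqrtTwo QSqrtTwo (radicand n))).range ⊓
    (unitsSubgroup ZSqrtTwo QSqrtTwo ⊔ squares QSqrtTwoˣ))

lemma squares_le_range : squares QSqrtTwoˣ ≤
    (unitsNorm QSqrtTwo (algebraMap ZSqrtTwo QSqrtTwo (radicand n))).range := by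
  rintro _ ⟨x, rfl⟩
  exact ⟨unitsIncl _ _ x, unitsNorm_unitsIncl x⟩

lemma isNormUnit_mul_sq {u : ZSqrtTwoˣ} (y : ZSqrtTwoˣ) :
    IsNormUnit n (u * y ^ 2) ↔ IsNormUnit n u := by
  rw [IsNormUnit, IsNormUnit, map_mul, map_pow]
  exact Subgroup.mul_mem_cancel_right _ (squares_le_range n (sq_mem_squares _))

lemma relIndex_squares_sup : (squares QSqrtTwoˣ).relIndex
    (unitsSubgroup ZSqrtTwo QSqrtTwo ⊔ squares QSqrtTwoˣ) = 4 := by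
  rw [Subgroup.relIndex_sup_right, relIndex_squares_unitsSubgroup, index_squares_ZSqrtTwo]

lemma normIndex_mul : normIndex n *
    ((unitsNorm QSqrtTwo (algebraMap ZSqrtTwo QSqrtTwo (radicand n))).range ⊓
      (unitsSubgroup ZSqrtTwo QSqrtTwo ⊔ squares QSqrtTwoˣ)).relIndex
      (unitsSubgroup ZSqrtTwo QSqrtTwo ⊔ squares QSqrtTwoˣ) = 4 := by
  rw [normIndex, Subgroup.relIndex_mul_relIndex _ _ _ (le_inf (squares_le_range n) le_sup_right)
    inf_le_right, relIndex_squares_sup]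

lemma normIndex_mem : normIndex n = 1 ∨ normIndex n = 2 ∨ normIndex n = 4 := by
  have h : normIndex n ∣ 2 ^ 2 := ⟨_, (normIndex_mul n).symm⟩
  obtain ⟨j, hj, h⟩ := (Nat.dvd_prime_pow Nat.prime_two).mp h
  interval_cases j <;> simp [h]

lemma normIndex_eq_four_iff : normIndex n = 4 ↔ ∀ u, IsNormUnit n u := by
  have h := normIndex_mul n
  have h1 : normIndex n = 4 ↔ ((unitsNorm QSqrtTwo
      (algebraMap ZSqrtTwo QSqrtTwo (radicand n))).range ⊓
      (unitsSubgroup ZSqrtTwo QSqrtTwo ⊔ squares QSqrtTwoˣ)).relIndex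
      (unitsSubgroup ZSqrtTwo QSqrtTwo ⊔ squares QSqrtTwoˣ) = 1 := by
    constructor
    · intro h'
      rw [h'] at h
      omega
    · intro h'
      rwa [h', mul_one] at h
  rw [h1, Subgroup.relIndex_eq_one]
  constructor
  · intro h u
    exact (h (Subgroup.mem_sup_left ⟨u, rfl⟩)).1
  · intro h
    refine le_inf (sup_le ?_ (squares_le_range n)) le_rfl
    rintro _ ⟨u, rfl⟩
    exact h u

lemma normIndex_eq_one_iff :
    normIndex n = 1 ↔ ∀ u, IsNormUnit n u → u ∈ squares ZSqrtTwoˣ := by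
  have hsq : ∀ u : ZSqrtTwoˣ, Units.map (algebraMap ZSqrtTwo QSqrtTwo : ZSqrtTwo →* QSqrtTwo) u ∈
      squares QSqrtTwoˣ → u ∈ squares ZSqrtTwoˣ := by
    rintro u ⟨y, hy⟩
    have hint : ∃ z, algebraMap ZSqrtTwo QSqrtTwo z = (y : QSqrtTwo) := by
      refine IsIntegrallyClosed.exists_algebraMap_eq_of_isIntegral_pow (n := 2) two_pos ?_
      have := congrArg Units.val hy
      rw [powMonoidHom_apply, Units.val_pow_eq_pow_val] at this
      rw [this]
      exact isIntegral_algebraMap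
    obtain ⟨z, hz⟩ := hint
    have h1 : z ^ 2 = u := by
      apply IsFractionRing.injective ZSqrtTwo QSqrtTwo
      rw [map_pow, hz]
      exact congrArg Units.val hy
    have hzu : IsUnit z := (isUnit_pow_iff two_ne_zero).mp (h1 ▸ u.isUnit)
    exact ⟨hzu.unit, by ext1; simpa using h1⟩
  rw [normIndex, Subgroup.relIndex_eq_one]
  constructor
  · intro h u hu
    exact hsq u (h ⟨hu, Subgroup.mem_sup_left ⟨u, rfl⟩⟩)
  · rintro h x ⟨hx, hx'⟩
    obtain ⟨_, ⟨u, rfl⟩, y, hy, rfl⟩ := Subgroup.mem_sup.mp hx'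
    have hu : IsNormUnit n u :=
      (Subgroup.mul_mem_cancel_right _ (squares_le_range n hy)).mp hx
    exact mul_mem (map_squares_le _ ⟨u, h u hu, rfl⟩) hy

open ZSqrtTwo

lemma normIndex_eq_four (h₁ : IsNormUnit n (-1)) (h₂ : IsNormUnit n ε) : normIndex n = 4 := by
  rw [normIndex_eq_four_iff]
  intro u
  have h3 : IsNormUnit n (-ε) := by
    rw [IsNormUnit, ← neg_one_mul, map_mul]
    exact mul_mem h₁ h₂
  obtain ⟨y, rfl | rfl | rfl | rfl⟩ := exists_eq_mul_sq u
  · rw [← one_mul (y ^ 2), isNormUnit_mul_sq, IsNormUnit, map_one]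
    exact one_mem _
  all_goals rwa [isNormUnit_mul_sq]

lemma normIndex_eq_one (h₁ : ¬ IsNormUnit n (-1)) (h₂ : ¬ IsNormUnit n ε)
    (h₃ : ¬ IsNormUnit n (-ε)) : normIndex n = 1 := by
  rw [normIndex_eq_one_iff]
  intro u hu
  obtain ⟨y, rfl | rfl | rfl | rfl⟩ := exists_eq_mul_sq u
  · exact sq_mem_squares y
  all_goals
    rw [isNormUnit_mul_sq] at hu
    contradiction

lemma normIndex_ne_one (h₁ : IsNormUnit n (-1)) : normIndex n ≠ 1 := by
  intro h
  exact neg_one_notMem_squares ((normIndex_eq_one_iff n).mp h _ h₁)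

lemma normIndex_ne_four (h₂ : ¬ IsNormUnit n ε) : normIndex n ≠ 4 := by
  intro h
  exact h₂ ((normIndex_eq_four_iff n).mp h _)

end NormUnits

section PrimeFactorization

/-- `s` is a set of pairwise non-associated primes whose product is associated to `a`. -/
structure IsPrimeFactorization {R : Type*} [CommRing R] (a : R) (s : Finset R) : Prop where
  prime : ∀ p ∈ s, Prime p
  eq_of_dvd : ∀ p ∈ s, ∀ q ∈ s, p ∣ q → p = q
  associated : Associated a (∏ p ∈ s, p)

namespace IsPrimeFactorization

variable {R : Type*} [CommRing R] {a b : R} {s t : Finset R}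

lemma dvd (h : IsPrimeFactorization a s) {p : R} (hp : p ∈ s) : p ∣ a :=
  (Finset.dvd_prod_of_mem _ hp).trans h.associated.symm.dvd

lemma exists_associated [IsDomain R] (h : IsPrimeFactorization a s) {p : R} (hp : Prime p)
    (hpa : p ∣ a) : ∃ q ∈ s, Associated p q := by
  obtain ⟨q, hq, hpq⟩ := (hp.dvd_finsetProd_iff _).mp (hpa.trans h.associated.dvd)
  exact ⟨q, hq, hp.associated_of_dvd (h.prime q hq) hpq⟩

lemma singleton (h : Prime a) : IsPrimeFactorization a {a} where
  prime p hp := by rwa [Finset.mem_singleton.mp hp]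
  eq_of_dvd p hp q hq _ := by rw [Finset.mem_singleton.mp hp, Finset.mem_singleton.mp hq]
  associated := by simp

lemma empty_one : IsPrimeFactorization (1 : R) ∅ where
  prime p hp := by simp at hp
  eq_of_dvd p hp := by simp at hp
  associated := by simp

lemma congr_associated (h : IsPrimeFactorization a s) (hab : Associated b a) :
    IsPrimeFactorization b s :=
  ⟨h.prime, h.eq_of_dvd, hab.trans h.associated⟩

lemma not_dvd (hs : IsPrimeFactorization a s) (ht : IsPrimeFactorization b t)
    (hab : IsCoprime a b) {p q : R} (hp : p ∈ s) (hq : q ∈ t) : ¬ p ∣ q := fun h =>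
  (hs.prime p hp).not_isUnit (hab.isUnit_of_dvd' (hs.dvd hp) (h.trans (ht.dvd hq)))

lemma disjoint (hs : IsPrimeFactorization a s) (ht : IsPrimeFactorization b t)
    (hab : IsCoprime a b) : Disjoint s t :=
  Finset.disjoint_left.mpr fun _ hp hp' => hs.not_dvd ht hab hp hp' dvd_rfl

lemma union [DecidableEq R] (hs : IsPrimeFactorization a s) (ht : IsPrimeFactorization b t)
    (hab : IsCoprime a b) : IsPrimeFactorization (a * b) (s ∪ t) where
  prime p hp := (Finset.mem_union.mp hp).elim (hs.prime p) (ht.prime p)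
  eq_of_dvd p hp q hq h := by
    rcases Finset.mem_union.mp hp with hp | hp <;> rcases Finset.mem_union.mp hq with hq | hq
    · exact hs.eq_of_dvd p hp q hq h
    · exact absurd h (hs.not_dvd ht hab hp hq)
    · exact absurd h (ht.not_dvd hs hab.symm hp hq)
    · exact ht.eq_of_dvd p hp q hq h
  associated := by
    rw [Finset.prod_union (hs.disjoint ht hab)]
    exact hs.associated.mul_mul ht.associated

lemma squarefree [IsDomain R] [IsPrincipalIdealRing R] (h : IsPrimeFactorization a s) :
    Squarefree a := by
  refine (h.associated.squarefree_iff).mpr (Finset.squarefree_prod_of_pairwise_isCoprime ?_ ?_)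
  · intro p hp q hq hpq
    exact (((h.prime p hp).irreducible.coprime_iff_not_dvd).mpr fun hdvd =>
      hpq (h.eq_of_dvd p hp q hq hdvd)).isRelPrime
  · exact fun p hp => (h.prime p hp).irreducible.squarefree

end IsPrimeFactorization

namespace ZSqrtTwo

@[simp] lemma norm_natCast (m : ℕ) : QuadraticAlgebra.norm (m : ZSqrtTwo) = (m : ℤ) * m := by
  rw [norm_eq]; simp

lemma natCast_dvd_iff {m : ℕ} {z : ZSqrtTwo} :
    (m : ZSqrtTwo) ∣ z ↔ (m : ℤ) ∣ z.re ∧ (m : ℤ) ∣ z.im := by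
  constructor
  · rintro ⟨w, rfl⟩
    exact ⟨⟨w.re, by simp⟩, ⟨w.im, by simp⟩⟩
  · rintro ⟨⟨a, ha⟩, ⟨b, hb⟩⟩
    exact ⟨⟨a, b⟩, by ext <;> simp [ha, hb]⟩

lemma natAbs_norm_of_mul_eq {p : ℕ} (hp : p.Prime) {a b : ZSqrtTwo} (hab : (p : ZSqrtTwo) = a * b)
    (ha : ¬ IsUnit a) (hb : ¬ IsUnit b) :
    (QuadraticAlgebra.norm a).natAbs = p ∧ (QuadraticAlgebra.norm b).natAbs = p := by
  have h := congrArg (fun z => (QuadraticAlgebra.norm z).natAbs) hab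
  simp only [norm_natCast, map_mul, Int.natAbs_mul, Int.natAbs_natCast] at h
  rw [isUnit_iff_norm] at ha hb
  exact (hp.mul_eq_prime_sq_iff ha hb).mp (by rw [← h, sq])

lemma prime_natCast {p : ℕ} (hp : p.Prime) (h8 : p % 8 = 3 ∨ p % 8 = 5) : Prime (p : ZSqrtTwo) := by
  rw [← irreducible_iff_prime]
  refine ⟨fun hu => ?_, fun a b hab => ?_⟩
  · rw [isUnit_iff_norm, norm_natCast, Int.natAbs_mul, Int.natAbs_natCast] at hu
    exact hp.one_lt.ne' (Nat.eq_one_of_mul_eq_one_right hu)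
  · by_contra! h
    have h1 := (natAbs_norm_of_mul_eq hp hab h.1 h.2).1
    rw [norm_eq] at h1
    have h2 : a.re * a.re - 2 * (a.im * a.im) = p ∨ a.re * a.re - 2 * (a.im * a.im) = -p := by omega
    have h3 : a.re * a.re % 8 = 0 ∨ a.re * a.re % 8 = 1 ∨ a.re * a.re % 8 = 4 := by
      have := Int.emod_nonneg a.re (b := 8) (by norm_num)
      have := Int.emod_lt_of_pos a.re (b := 8) (by norm_num)
      rw [Int.mul_emod]
      interval_cases a.re % 8 <;> simp
    have h4 : a.im * a.im % 4 = 0 ∨ a.im * a.im % 4 = 1 := by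
      have := Int.emod_nonneg a.im (b := 4) (by norm_num)
      have := Int.emod_lt_of_pos a.im (b := 4) (by norm_num)
      rw [Int.mul_emod]
      interval_cases a.im % 4 <;> simp
    omega

lemma exists_eq_mul {p : ℕ} (hp : p.Prime) (h8 : p % 8 = 1 ∨ p % 8 = 7) :
    ∃ a b : ZSqrtTwo, (p : ZSqrtTwo) = a * b ∧ (QuadraticAlgebra.norm a).natAbs = p ∧
      (QuadraticAlgebra.norm b).natAbs = p := by
  have hf := Fact.mk hp
  obtain ⟨s, hs⟩ := (ZMod.exists_sq_eq_two_iff (by rintro rfl; omega)).mpr h8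
  have hirr : ¬ Irreducible (p : ZSqrtTwo) := by
    rw [irreducible_iff_prime]
    intro hprime
    have hdvd : (p : ℤ) ∣ (s.val : ℤ) * s.val - 2 := by
      rw [← ZMod.intCast_zmod_eq_zero_iff_dvd]
      simp [hs]
    have hmul : (p : ZSqrtTwo) ∣ (⟨s.val, 1⟩ : ZSqrtTwo) * ⟨s.val, -1⟩ := by
      rw [natCast_dvd_iff]
      constructor
      · simpa [sub_eq_add_neg] using hdvd
      · simp
    have h1 : ¬ (p : ℤ) ∣ 1 := by
      intro h
      exact hp.one_lt.ne' (by exact_mod_cast Int.eq_one_of_dvd_one (by positivity) h)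
    rcases hprime.dvd_or_dvd hmul with h | h
    · exact h1 (natCast_dvd_iff.mp h).2
    · exact h1 (by simpa using (natCast_dvd_iff.mp h).2)
  rw [irreducible_iff] at hirr
  push Not at hirr
  obtain ⟨a, b, hab, ha, hb⟩ := hirr (by
    rw [isUnit_iff_norm, norm_natCast, Int.natAbs_mul, Int.natAbs_natCast]
    exact fun h => hp.one_lt.ne' (Nat.eq_one_of_mul_eq_one_right h))
  exact ⟨a, b, hab, natAbs_norm_of_mul_eq hp hab ha hb⟩

lemma not_dvd_of_mul_eq {p : ℕ} (hp : p.Prime) (h2 : p ≠ 2) {a b : ZSqrtTwo}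
    (hab : (p : ZSqrtTwo) = a * b) (ha : (QuadraticAlgebra.norm a).natAbs = p) : ¬ a ∣ b := by
  have hp' := Nat.prime_iff_prime_int.mp hp
  have ha0 : a ≠ 0 := by
    rintro rfl
    simp at ha
    exact hp.ne_zero ha.symm
  intro h
  have h1 : a ∣ star a := by
    have h3 := algebraMap_norm_eq_mul_star a
    have h4 : star a = b ∨ star a = -b := by
      rcases Int.natAbs_eq (QuadraticAlgebra.norm a) with h5 | h5
      · left
        apply mul_left_cancel₀ ha0
        rw [← h3, ← hab, h5, ha]
        simp
      · right
        apply mul_left_cancel₀ ha0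
        rw [← h3, mul_neg, ← hab, h5, ha]
        simp
    rcases h4 with h4 | h4 <;> rw [h4]
    · exact h
    · exact h.neg_right
  have h3 : a ∣ ((2 * a.re : ℤ) : ZSqrtTwo) := by
    have : ((2 * a.re : ℤ) : ZSqrtTwo) = a + star a := by
      ext
      · simp; ring
      · simp
    rw [this]
    exact dvd_add dvd_rfl h1
  have hpN : (p : ℤ) ∣ QuadraticAlgebra.norm a := by
    rw [← ha]; exact Int.natAbs_dvd.mpr dvd_rfl
  have hp2 : ¬ (p : ℤ) ∣ 2 := fun h => h2 ((Nat.prime_dvd_prime_iff_eq hp Nat.prime_two).mp (by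
    exact_mod_cast h))
  have hre : (p : ℤ) ∣ a.re := by
    have h4 : (p : ℤ) ∣ (2 * a.re) * (2 * a.re) := by
      have := hpN.trans (map_dvd QuadraticAlgebra.norm h3)
      rw [norm_eq] at this
      simpa using this
    exact ((hp'.dvd_or_dvd ((hp'.dvd_or_dvd h4).elim id id)).resolve_left hp2)
  have him : (p : ℤ) ∣ a.im := by
    rw [norm_eq] at hpN
    have h4 : (p : ℤ) ∣ 2 * (a.im * a.im) := by
      have := dvd_sub (hre.mul_right a.re) hpN
      simpa using this
    exact (hp'.dvd_or_dvd ((hp'.dvd_or_dvd h4).resolve_left hp2)).elim id id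
  obtain ⟨c, hc⟩ := natCast_dvd_iff.mpr ⟨hre, him⟩
  have h5 : p * p ∣ p := by
    have := congrArg (fun z => (QuadraticAlgebra.norm z).natAbs) hc
    simp only [map_mul, norm_natCast, Int.natAbs_mul, Int.natAbs_natCast, ha] at this
    exact ⟨_, this⟩
  have := Nat.le_of_dvd hp.pos h5
  nlinarith [hp.one_lt]

/-- The number of primes of `ℤ[√2]` above the odd prime number `p`. -/
def numPrimesAbove (p : ℕ) : ℕ := if p % 8 = 1 ∨ p % 8 = 7 then 2 else 1

lemma exists_isPrimeFactorization_prime {p : ℕ} (hp : p.Prime) (h2 : p % 2 = 1) :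
    ∃ s : Finset ZSqrtTwo, IsPrimeFactorization (p : ZSqrtTwo) s ∧ s.card = numPrimesAbove p := by
  classical
  by_cases h8 : p % 8 = 1 ∨ p % 8 = 7
  · obtain ⟨a, b, hab, ha, hb⟩ := exists_eq_mul hp h8
    have ha' : Prime a := irreducible_iff_prime.mp (irreducible_of_norm_prime (ha ▸ hp))
    have hb' : Prime b := irreducible_iff_prime.mp (irreducible_of_norm_prime (hb ▸ hp))
    have hnd := not_dvd_of_mul_eq hp (by rintro rfl; omega) hab ha
    have hcop : IsCoprime a b := (ha'.irreducible.coprime_iff_not_dvd).mpr hnd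
    refine ⟨{a} ∪ {b}, hab ▸ (IsPrimeFactorization.singleton ha').union (.singleton hb') hcop, ?_⟩
    rw [Finset.card_union_of_disjoint ((IsPrimeFactorization.singleton ha').disjoint
      (.singleton hb') hcop), numPrimesAbove, if_pos h8]
    simp
  · exact ⟨{(p : ZSqrtTwo)}, .singleton (prime_natCast hp (by omega)), by
      rw [numPrimesAbove, if_neg h8, Finset.card_singleton]⟩

lemma exists_isPrimeFactorization (n : ℕ) (hn : Odd n) (hsq : Squarefree n) :
    ∃ s : Finset ZSqrtTwo, IsPrimeFactorization (n : ZSqrtTwo) s ∧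
      s.card = ∑ p ∈ n.primeFactors, numPrimesAbove p := by
  classical
  induction n using Nat.recOnMul with
  | zero => simp at hsq
  | one => exact ⟨∅, by simpa using IsPrimeFactorization.empty_one, by simp⟩
  | prime p hp =>
    obtain ⟨s, hs, h⟩ := exists_isPrimeFactorization_prime hp (Nat.odd_iff.mp hn)
    exact ⟨s, hs, by rw [h, hp.primeFactors, Finset.sum_singleton]⟩
  | mul a b iha ihb =>
    rw [Nat.odd_mul] at hn
    have hab := Nat.coprime_of_squarefree_mul hsq
    obtain ⟨s, hs, hs'⟩ := iha hn.1 (hsq.squarefree_of_dvd (dvd_mul_right _ _))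
    obtain ⟨t, ht, ht'⟩ := ihb hn.2 (hsq.squarefree_of_dvd (dvd_mul_left _ _))
    have hcop : IsCoprime (a : ZSqrtTwo) b := by
      simpa using (Nat.isCoprime_iff_coprime.mpr hab).map (Int.castRingHom ZSqrtTwo)
    refine ⟨s ∪ t, by simpa using hs.union ht hcop, ?_⟩
    rw [Finset.card_union_of_disjoint (hs.disjoint ht hcop), hs', ht', hab.primeFactors_mul,
      Finset.sum_union hab.disjoint_primeFactors]

lemma exists_isPrimeFactorization_radicand (n : ℕ) (hn : Odd n) (hsq : Squarefree n) :
    ∃ s : Finset ZSqrtTwo, IsPrimeFactorization (radicand n) s ∧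
      s.card = (∑ p ∈ n.primeFactors, numPrimesAbove p) + 1 := by
  classical
  obtain ⟨s, hs, h⟩ := exists_isPrimeFactorization n hn hsq
  have hcop : IsCoprime (n : ZSqrtTwo) sqrtTwo := by
    have h1 : IsCoprime (n : ZSqrtTwo) (2 : ZSqrtTwo) := by
      simpa using (Nat.isCoprime_iff_coprime.mpr (Nat.coprime_two_right.mpr hn)).map
        (Int.castRingHom ZSqrtTwo)
    rw [← sqrtTwo_mul_self] at h1
    exact h1.of_mul_right_left
  have hp := IsPrimeFactorization.singleton prime_sqrtTwo
  refine ⟨s ∪ {sqrtTwo}, (hs.union hp hcop).congr_associated ?_, ?_⟩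
  · refine Associated.symm ⟨ε, ?_⟩
    ext <;> simp [sqrtTwo]
  · rw [Finset.card_union_of_disjoint (hs.disjoint hp hcop), h, Finset.card_singleton]

end ZSqrtTwo

end PrimeFactorization

section IsNormOf

/-- `b` is a value of the norm form `x² - a y²`. -/
def IsNormOf {k : Type*} [CommRing k] (a b : k) : Prop := ∃ x y, x * x - a * (y * y) = b

namespace IsNormOf

variable {k : Type*}

lemma sq [CommRing k] (a x : k) : IsNormOf a (x * x) := ⟨x, 0, by ring⟩

lemma one [CommRing k] (a : k) : IsNormOf a 1 := ⟨1, 0, by ring⟩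

lemma neg_self [CommRing k] (a : k) : IsNormOf a (-a) := ⟨0, 1, by ring⟩

lemma mul [CommRing k] {a b c : k} (hb : IsNormOf a b) (hc : IsNormOf a c) :
    IsNormOf a (b * c) := by
  obtain ⟨x, y, rfl⟩ := hb
  obtain ⟨z, w, rfl⟩ := hc
  exact ⟨x * z + a * y * w, x * w + y * z, by ring⟩

variable [Field k] {a b c : k}

lemma of_mul (hb : IsNormOf a b) (hb0 : b ≠ 0) (hbc : IsNormOf a (b * c)) : IsNormOf a c := by
  have := (hb.mul hbc).mul (sq a b⁻¹)
  convert this using 1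
  field_simp

lemma of_mul_sq (hb0 : b ≠ 0) (hbc : IsNormOf a (b * b * c)) : IsNormOf a c :=
  (sq a b).of_mul (mul_ne_zero hb0 hb0) hbc

lemma symm (h2 : (2 : k) ≠ 0) (hb0 : b ≠ 0) (h : IsNormOf a b) : IsNormOf b a := by
  obtain ⟨x, y, hxy⟩ := h
  rcases eq_or_ne y 0 with rfl | hy
  · have hx : x ≠ 0 := by
      rintro rfl
      exact hb0 (by rw [← hxy]; ring)
    refine ⟨(a + 1) / 2, (a - 1) / (2 * x), ?_⟩
    rw [← hxy]
    field_simp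
    ring
  · refine ⟨x / y, 1 / y, ?_⟩
    rw [← hxy]
    field_simp
    ring

lemma natCast {n : ℕ} (hn : n ≠ 0) (h : ∀ p : ℕ, p.Prime → p ∣ n → IsNormOf a (p : k)) :
    IsNormOf a (n : k) := by
  induction n using Nat.recOnMul with
  | zero => exact absurd rfl hn
  | one => simpa using one a
  | prime p hp => exact h p hp dvd_rfl
  | mul m n ihm ihn =>
    rw [mul_ne_zero_iff] at hn
    rw [Nat.cast_mul]
    exact (ihm hn.1 fun p hp hpm => h p hp (hpm.mul_right n)).mul
      (ihn hn.2 fun p hp hpn => h p hp (hpn.mul_left m))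

end IsNormOf

end IsNormOf

section NormUnits

variable (n : ℕ) [NeZero n]

lemma isNormUnit_iff (u : ZSqrtTwoˣ) : IsNormUnit n u ↔
    IsNormOf (algebraMap ZSqrtTwo QSqrtTwo (radicand n)) (algebraMap ZSqrtTwo QSqrtTwo u) := by
  constructor
  · rintro ⟨x, hx⟩
    have h := congrArg Units.val hx
    refine ⟨x.val.re, x.val.im, ?_⟩
    rw [Units.coe_map] at h
    refine Eq.trans ?_ h
    change _ = QuadraticAlgebra.norm x.val
    rw [norm_def]
    ring
  · rintro ⟨x, y, h⟩
    have hN : QuadraticAlgebra.norm (⟨x, y⟩ : QuadraticAlgebra QSqrtTwo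
        (algebraMap ZSqrtTwo QSqrtTwo (radicand n)) 0) = algebraMap ZSqrtTwo QSqrtTwo u := by
      rw [norm_def, ← h]
      ring
    have h0 : (⟨x, y⟩ : QuadraticAlgebra QSqrtTwo
        (algebraMap ZSqrtTwo QSqrtTwo (radicand n)) 0) ≠ 0 := by
      intro h0
      rw [h0, QuadraticAlgebra.norm_zero, eq_comm,
        map_eq_zero_iff _ (IsFractionRing.injective ZSqrtTwo QSqrtTwo)] at hN
      exact u.ne_zero hN
    exact ⟨Units.mk0 _ h0, Units.ext hN⟩

lemma isNormUnit_of_isNormOf {u : ZSqrtTwoˣ}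
    (h : IsNormOf (algebraMap ZSqrtTwo QSqrtTwo u) (algebraMap ZSqrtTwo QSqrtTwo (radicand n))) :
    IsNormUnit n u := by
  rw [isNormUnit_iff]
  refine h.symm two_ne_zero ?_
  rw [Ne, map_eq_zero_iff _ (IsFractionRing.injective ZSqrtTwo QSqrtTwo)]
  intro h0
  have := congrArg QuadraticAlgebra.im h0
  simp [NeZero.ne n] at this

omit [NeZero n] in
lemma algebraMap_radicand : algebraMap ZSqrtTwo QSqrtTwo (radicand n) =
    algebraMap ZSqrtTwo QSqrtTwo (ZSqrtTwo.sqrtTwo * ZSqrtTwo.ε) * (n : QSqrtTwo) := by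
  rw [← map_natCast (algebraMap ZSqrtTwo QSqrtTwo), ← map_mul]
  congr 1
  ext <;> simp [ZSqrtTwo.sqrtTwo]

end NormUnits

section NegOne

lemma algebraMap_sqrtTwo_mul_self :
    algebraMap ZSqrtTwo QSqrtTwo ZSqrtTwo.sqrtTwo * algebraMap ZSqrtTwo QSqrtTwo ZSqrtTwo.sqrtTwo
      = 2 := by
  rw [← map_mul, ZSqrtTwo.sqrtTwo_mul_self, map_ofNat]

lemma algebraMap_ε : algebraMap ZSqrtTwo QSqrtTwo ZSqrtTwo.ε =
    1 + algebraMap ZSqrtTwo QSqrtTwo ZSqrtTwo.sqrtTwo := by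
  rw [← map_one (algebraMap ZSqrtTwo QSqrtTwo), ← map_add]
  rfl

lemma isNormOf_neg_one_of_dvd (m : ℕ) (hm : 0 < m) (x : ℤ) (h : (m : ℤ) ∣ x ^ 2 + 2) :
    IsNormOf (-1 : QSqrtTwo) (m : QSqrtTwo) := by
  induction m using Nat.strong_induction_on generalizing x with
  | _ m ih =>
    rcases (show m = 1 ∨ 2 ≤ m by omega) with rfl | hm2
    · simpa using IsNormOf.one _
    obtain ⟨r, q, hr, hxr⟩ : ∃ r q : ℤ, 2 * |r| ≤ m ∧ x = r + m * q := by
      refine ⟨x.bmod m, x.bdiv m, ?_, ?_⟩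
      · have h1 := Int.le_bmod (x := x) (m := m) hm
        have h2 := Int.bmod_lt (x := x) (m := m) hm
        rcases abs_cases (x.bmod m) with ⟨h, -⟩ | ⟨h, -⟩ <;> rw [h] <;> omega
      · rw [Int.bmod_add_bdiv]
    have hdvd : (m : ℤ) ∣ r ^ 2 + 2 := by
      have : r ^ 2 + 2 = x ^ 2 + 2 - m * (q * (x + r)) := by rw [hxr]; ring
      rw [this]
      exact dvd_sub h (dvd_mul_right _ _)
    obtain ⟨m', hm'⟩ := hdvd
    have hm'0 : 0 < m' := by
      by_contra! hneg
      nlinarith [sq_nonneg r]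
    have hlt : m' < m := by
      have : 4 * r ^ 2 ≤ m * m := by
        rw [← sq_abs r]; nlinarith [abs_nonneg r]
      by_contra! hge
      have hm2' : (2 : ℤ) ≤ m := by exact_mod_cast hm2
      nlinarith
    lift m' to ℕ using hm'0.le
    have h1 := ih m' (by exact_mod_cast hlt) (by exact_mod_cast hm'0) r ⟨m, by rw [hm']; ring⟩
    refine h1.of_mul (by exact_mod_cast hm'0.ne') ⟨(r : QSqrtTwo),
      algebraMap ZSqrtTwo QSqrtTwo ZSqrtTwo.sqrtTwo, ?_⟩
    rw [algebraMap_sqrtTwo_mul_self]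
    have := congrArg (Int.cast : ℤ → QSqrtTwo) hm'
    push_cast at this
    linear_combination this

lemma isNormOf_neg_one_prime {p : ℕ} (hp : p.Prime) (h2 : p % 2 = 1) (h7 : p % 8 ≠ 7) :
    IsNormOf (-1 : QSqrtTwo) (p : QSqrtTwo) := by
  have hf := Fact.mk hp
  by_cases h4 : p % 4 = 3
  · obtain ⟨s, hs⟩ := (ZMod.exists_sq_eq_neg_two_iff (p := p) (by rintro rfl; omega)).mpr (by omega)
    refine isNormOf_neg_one_of_dvd p hp.pos s.val ?_
    rw [← ZMod.intCast_zmod_eq_zero_iff_dvd]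
    push_cast
    rw [ZMod.natCast_val, ZMod.cast_id]
    linear_combination -hs
  · obtain ⟨a, b, h⟩ := Nat.Prime.sq_add_sq (p := p) h4
    refine ⟨a, b, ?_⟩
    have := congrArg (Nat.cast : ℕ → QSqrtTwo) h
    push_cast at this
    linear_combination this

lemma isNormUnit_neg_one (n : ℕ) [NeZero n] (hn : Odd n)
    (h : ∀ p : ℕ, p.Prime → p ∣ n → p % 8 ≠ 7) : IsNormUnit n (-1) := by
  refine isNormUnit_of_isNormOf n ?_
  rw [algebraMap_radicand, Units.val_neg, Units.val_one, map_neg, map_one]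
  refine IsNormOf.mul ?_ (IsNormOf.natCast (NeZero.ne n) fun p hp hpn =>
    isNormOf_neg_one_prime hp (Nat.odd_iff.mp (hn.of_dvd_nat hpn)) (h p hp hpn))
  have h2 := algebraMap_sqrtTwo_mul_self
  have h2' : (2 : QSqrtTwo) ≠ 0 := two_ne_zero
  rw [map_mul, algebraMap_ε]
  set s := algebraMap ZSqrtTwo QSqrtTwo ZSqrtTwo.sqrtTwo
  refine ⟨1 + s / 2, s / 2, ?_⟩
  field_simp
  linear_combination (-2) * h2

end NegOne

section Reduction

namespace ZSqrtTwo

/-- Every element of `ℤ[√2]` has an associate whose coordinates are small. -/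
lemma exists_associated_bound (m : ZSqrtTwo) : ∃ m', Associated m m' ∧
    (4 * |m'.im| ≤ |m'.re| ∨ 3 * |m'.re| ≤ 2 * |m'.im|) := by
  obtain ⟨u, hu⟩ : ∃ u : ZSqrtTwoˣ, ∀ v : ZSqrtTwoˣ,
      |(m * u).re| + |(m * u).im| ≤ |(m * v).re| + |(m * v).im| := by
    obtain ⟨u, -, hu⟩ := WellFounded.has_min
      (InvImage.wf (fun u : ZSqrtTwoˣ => (|(m * u).re| + |(m * u).im|).toNat) Nat.lt_wfRel.wf)
      Set.univ ⟨1, trivial⟩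
    refine ⟨u, fun v => ?_⟩
    have h : ¬ (|(m * v).re| + |(m * v).im|).toNat < (|(m * u).re| + |(m * u).im|).toNat :=
      hu v trivial
    have := abs_nonneg (m * v : ZSqrtTwo).re
    have := abs_nonneg (m * v : ZSqrtTwo).im
    omega
  refine ⟨m * u, ⟨u, rfl⟩, ?_⟩
  have h1 := hu (u * ε)
  have h2 := hu (u * ε⁻¹)
  rw [Units.val_mul, ← mul_assoc] at h1 h2
  generalize m * (u : ZSqrtTwo) = z at *
  have e1 : (z * ε).re = z.re + 2 * z.im := by simp
  have e2 : (z * ε).im = z.im + z.re := by simp; ring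
  have e3 : (z * (ε⁻¹ : ZSqrtTwoˣ)).re = -z.re + 2 * z.im := by
    simp [ε]
  have e4 : (z * (ε⁻¹ : ZSqrtTwoˣ)).im = z.re - z.im := by
    simp [ε]; ring
  rw [e1, e2] at h1
  rw [e3, e4] at h2
  simp only [abs_eq_max_neg] at *
  omega

lemma mul_self_le_of_bound {z : ZSqrtTwo}
    (h : 4 * |z.im| ≤ |z.re| ∨ 3 * |z.re| ≤ 2 * |z.im|) :
    (4 * |z.im| ≤ |z.re| ∧ 7 * (|z.re| * |z.re|) ≤ 8 * |QuadraticAlgebra.norm z|) ∨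
      (3 * |z.re| ≤ 2 * |z.im| ∧ 14 * (|z.im| * |z.im|) ≤ 9 * |QuadraticAlgebra.norm z|) := by
  rw [norm_eq, ← abs_mul_abs_self z.re, ← abs_mul_abs_self z.im]
  have h1 := abs_nonneg z.re
  have h2 := abs_nonneg z.im
  generalize |z.re| = a at *
  generalize |z.im| = b at *
  rcases h with h | h
  · left
    refine ⟨h, ?_⟩
    have := le_abs_self (a * a - 2 * (b * b))
    nlinarith
  · right
    refine ⟨h, ?_⟩
    have := neg_le_abs (a * a - 2 * (b * b))
    nlinarith

/-- Division with small remainder for the norm of `x² - ε`. -/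
lemma exists_norm_sub_le (x : ZSqrtTwo) {m : ZSqrtTwo} (hm : m ≠ 0)
    (h : 4 * |m.im| ≤ |m.re| ∨ 3 * |m.re| ≤ 2 * |m.im|) : ∃ q : ZSqrtTwo,
    4 * |QuadraticAlgebra.norm ((x - q * m) ^ 2 - (ε : ZSqrtTwo))| ≤
      |QuadraticAlgebra.norm m| ^ 2 + 40 * |QuadraticAlgebra.norm m| + 4 := by
  obtain ⟨q, hA, hB⟩ := exists_sub_mul_star_bound x hm
  refine ⟨q, ?_⟩
  have hN : 0 < |QuadraticAlgebra.norm m| := abs_pos.mpr (norm_eq_zero_iff.not.mpr hm)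
  have h3 := norm_mul_star_of_mul (x := x - q * m) (m := m)
  generalize x - q * m = r at *
  have hre : r.re * QuadraticAlgebra.norm m =
        (r * star m).re * m.re + 2 * ((r * star m).im * m.im) := by
    rw [norm_eq]; simp; ring
  have him : r.im * QuadraticAlgebra.norm m = (r * star m).re * m.im + (r * star m).im * m.re := by
    rw [norm_eq]; simp; ring
  generalize (r * star m).re = A at *
  generalize (r * star m).im = B at *
  have key := mul_self_le_of_bound h
  have hNr : 2 * |QuadraticAlgebra.norm r| ≤ |QuadraticAlgebra.norm m| := by
    have h4 : 4 * (|QuadraticAlgebra.norm r| * |QuadraticAlgebra.norm m|) ≤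
        2 * (|QuadraticAlgebra.norm m| * |QuadraticAlgebra.norm m|) := by
      rw [← abs_mul, h3]
      have hA' : 4 * (A * A) ≤ |QuadraticAlgebra.norm m| * |QuadraticAlgebra.norm m| := by
        rw [← abs_mul_abs_self A]; nlinarith [abs_nonneg A]
      have hB' : 4 * (B * B) ≤ |QuadraticAlgebra.norm m| * |QuadraticAlgebra.norm m| := by
        rw [← abs_mul_abs_self B]; nlinarith [abs_nonneg B]
      rcases abs_cases (A * A - 2 * (B * B)) with ⟨h, -⟩ | ⟨h, -⟩ <;> rw [h] <;>
        nlinarith [mul_self_nonneg A, mul_self_nonneg B]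
    nlinarith
  have hX : 2 * |r.re| ≤ |m.re| + 2 * |m.im| := by
    have h4 : 2 * |r.re| * |QuadraticAlgebra.norm m| ≤
        (|m.re| + 2 * |m.im|) * |QuadraticAlgebra.norm m| := by
      rw [mul_assoc, ← abs_mul, hre]
      calc 2 * |A * m.re + 2 * (B * m.im)| ≤ 2 * (|A| * |m.re| + 2 * (|B| * |m.im|)) := by
            rw [← abs_mul, ← abs_mul]
            have := abs_add_le (A * m.re) (2 * (B * m.im))
            rw [abs_mul 2, abs_two] at this
            linarith
        _ ≤ _ := by nlinarith [abs_nonneg m.re, abs_nonneg m.im]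
    exact le_of_mul_le_mul_right h4 hN
  have hY : 2 * |r.im| ≤ |m.re| + |m.im| := by
    have h4 : 2 * |r.im| * |QuadraticAlgebra.norm m| ≤
        (|m.re| + |m.im|) * |QuadraticAlgebra.norm m| := by
      rw [mul_assoc, ← abs_mul, him]
      calc 2 * |A * m.im + B * m.re| ≤ 2 * (|A| * |m.im| + |B| * |m.re|) := by
            rw [← abs_mul, ← abs_mul]
            have := abs_add_le (A * m.im) (B * m.re)
            linarith
        _ ≤ _ := by nlinarith [abs_nonneg m.re, abs_nonneg m.im]
    exact le_of_mul_le_mul_right h4 hN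
  have hT : |2 * (r.re * r.re) + 4 * (r.im * r.im) - 8 * (r.re * r.im)| ≤
      10 * |QuadraticAlgebra.norm m| := by
    have h4 : |2 * (r.re * r.re) + 4 * (r.im * r.im) - 8 * (r.re * r.im)| ≤
        2 * (|r.re| * |r.re|) + 4 * (|r.im| * |r.im|) + 8 * (|r.re| * |r.im|) := by
      rw [abs_mul_abs_self, abs_mul_abs_self, ← abs_mul, abs_le]
      have := neg_abs_le (r.re * r.im)
      have := le_abs_self (r.re * r.im)
      have := mul_self_nonneg r.re
      have := mul_self_nonneg r.im
      constructor <;> linarith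
    refine h4.trans ?_
    have := abs_nonneg r.re
    have := abs_nonneg r.im
    have ha := abs_nonneg m.re
    have hb := abs_nonneg m.im
    generalize |r.re| = X at *
    generalize |r.im| = Y at *
    generalize |m.re| = a at *
    generalize |m.im| = b at *
    have h5 : 4 * (X * X) ≤ (a + 2 * b) * (a + 2 * b) := by nlinarith
    have h6 : 4 * (Y * Y) ≤ (a + b) * (a + b) := by nlinarith
    have h7 : 4 * (X * Y) ≤ (a + 2 * b) * (a + b) := by nlinarith
    rcases key with ⟨k1, k2⟩ | ⟨k1, k2⟩ <;> nlinarith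
  have hexp : QuadraticAlgebra.norm (r ^ 2 - (ε : ZSqrtTwo)) = QuadraticAlgebra.norm r ^ 2 -
      (2 * (r.re * r.re) + 4 * (r.im * r.im) - 8 * (r.re * r.im)) - 1 := by
    simp only [norm_eq, sq, re_sub, im_sub, re_mul, im_mul, re_ε, im_ε]
    ring
  have h8 : |QuadraticAlgebra.norm (r ^ 2 - (ε : ZSqrtTwo))| ≤ |QuadraticAlgebra.norm r| ^ 2 +
      |2 * (r.re * r.re) + 4 * (r.im * r.im) - 8 * (r.re * r.im)| + 1 := by
    rw [hexp, ← abs_pow]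
    refine (abs_sub _ _).trans ?_
    rw [abs_one]
    have := abs_sub (QuadraticAlgebra.norm r ^ 2)
      (2 * (r.re * r.re) + 4 * (r.im * r.im) - 8 * (r.re * r.im))
    linarith
  have h9 : 4 * |QuadraticAlgebra.norm r| ^ 2 ≤ |QuadraticAlgebra.norm m| ^ 2 := by
    nlinarith [abs_nonneg (QuadraticAlgebra.norm r)]
  linarith

/-- Representatives up to units of the elements of norm at most `13` in absolute value. -/
lemma mem_of_norm_le {z : ZSqrtTwo} (hz : z ≠ 0)
    (h : 4 * |z.im| ≤ |z.re| ∨ 3 * |z.re| ≤ 2 * |z.im|)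
    (hN : |QuadraticAlgebra.norm z| ≤ 13) :
    ∃ w : ZSqrtTwo, (z = w ∨ z = -w) ∧
      (w = 1 ∨ w = 2 ∨ w = 3 ∨ w = sqrtTwo ∨ w = 2 * sqrtTwo ∨ w = ⟨1, 2⟩ ∨ w = ⟨1, -2⟩) := by
  have key := mul_self_le_of_bound h
  obtain ⟨a, b⟩ := z
  simp only at h key
  have hab : |a| ≤ 3 ∧ |b| ≤ 2 := by
    have := abs_nonneg a
    have := abs_nonneg b
    rcases key with ⟨k1, k2⟩ | ⟨k1, k2⟩
    · have : |a| ≤ 3 := by nlinarith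
      omega
    · have : |b| ≤ 2 := by nlinarith
      omega
  obtain ⟨⟨ha₁, ha₂⟩, ⟨hb₁, hb₂⟩⟩ := hab.imp abs_le.mp abs_le.mp
  clear key
  interval_cases a <;> interval_cases b <;> first
    | exact absurd h (by decide)
    | exact absurd rfl hz
    | exact ⟨1, by decide, by simp⟩
    | exact ⟨2, by decide, by simp⟩
    | exact ⟨3, by decide, by simp⟩
    | exact ⟨sqrtTwo, by decide, by simp⟩
    | exact ⟨2 * sqrtTwo, by decide, by simp⟩
    | exact ⟨⟨1, 2⟩, by decide, by simp⟩
    | exact ⟨⟨1, -2⟩, by decide, by simp⟩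

end ZSqrtTwo

end Reduction

section Descent

open ZSqrtTwo

/-- Some unit multiple of `m` is a norm from `ℚ(√2, √ε)`. -/
def IsUnitMulNorm (m : ZSqrtTwo) : Prop := ∃ u : ZSqrtTwoˣ,
  IsNormOf (algebraMap ZSqrtTwo QSqrtTwo ε) (algebraMap ZSqrtTwo QSqrtTwo (u * m))

namespace IsUnitMulNorm

lemma of_associated {m m' : ZSqrtTwo} (h : Associated m m') (hm : IsUnitMulNorm m') :
    IsUnitMulNorm m := by
  obtain ⟨v, rfl⟩ := h
  obtain ⟨u, hu⟩ := hm
  exact ⟨u * v, by convert hu using 2; rw [Units.val_mul]; ring⟩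

lemma of_sub (x y : ZSqrtTwo) : IsUnitMulNorm (x * x - ε * (y * y)) :=
  ⟨1, algebraMap ZSqrtTwo QSqrtTwo x, algebraMap ZSqrtTwo QSqrtTwo y, by simp⟩

lemma mul {m m' : ZSqrtTwo} (h : IsUnitMulNorm m) (h' : IsUnitMulNorm m') :
    IsUnitMulNorm (m * m') := by
  obtain ⟨u, hu⟩ := h
  obtain ⟨v, hv⟩ := h'
  refine ⟨u * v, ?_⟩
  convert hu.mul hv using 1
  rw [← map_mul, Units.val_mul]
  congr 1
  ring

lemma of_mul {m m' : ZSqrtTwo} (hm : m ≠ 0) (h : IsUnitMulNorm m) (h' : IsUnitMulNorm (m * m')) :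
    IsUnitMulNorm m' := by
  obtain ⟨u, hu⟩ := h
  obtain ⟨v, hv⟩ := h'
  refine ⟨u⁻¹ * v, hu.of_mul ?_ ?_⟩
  · rw [Ne, map_eq_zero_iff _ (IsFractionRing.injective ZSqrtTwo QSqrtTwo)]
    exact mul_ne_zero u.ne_zero hm
  · rw [← map_mul, Units.val_mul]
    refine (congrArg (fun z => IsNormOf (algebraMap ZSqrtTwo QSqrtTwo ε)
      (algebraMap ZSqrtTwo QSqrtTwo z)) ?_).mpr hv
    linear_combination (v * m * m' : ZSqrtTwo) * u.mul_inv

lemma of_norm_le {z x : ZSqrtTwo} (hz : z ≠ 0)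
    (h : 4 * |z.im| ≤ |z.re| ∨ 3 * |z.re| ≤ 2 * |z.im|)
    (hN : |QuadraticAlgebra.norm z| ≤ 13) (hdvd : z ∣ x ^ 2 - (ε : ZSqrtTwo)) :
    IsUnitMulNorm z := by
  obtain ⟨w, hw, hw'⟩ := mem_of_norm_le hz h hN
  have hzw : Associated z w := by
    rcases hw with rfl | rfl
    · rfl
    · exact (Associated.refl w).neg_left
  refine of_associated hzw ?_
  replace hdvd := hzw.symm.dvd.trans hdvd
  clear hw hN h hz hzw z
  have h1 : IsUnitMulNorm 1 := by simpa using of_sub 1 0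
  have hs : IsUnitMulNorm sqrtTwo := by
    refine of_associated ?_ (of_sub 1 1)
    exact ⟨-1, by ext <;> simp [sqrtTwo]⟩
  have h2 : IsUnitMulNorm 2 := sqrtTwo_mul_self ▸ hs.mul hs
  rcases hw' with rfl | rfl | rfl | rfl | rfl | rfl | rfl
  · exact h1
  · exact h2
  · obtain ⟨c, hc⟩ := hdvd
    have hre := congrArg (fun z => ((QuadraticAlgebra.re (z : ZSqrtTwo) : ℤ) : ZMod 3)) hc
    have him := congrArg (fun z => ((QuadraticAlgebra.im (z : ZSqrtTwo) : ℤ) : ZMod 3)) hc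
    have h3 : (3 : ZSqrtTwo) = ((3 : ℕ) : ZSqrtTwo) := rfl
    rw [h3] at hre him
    have h30 : (3 : ZMod 3) = 0 := by decide
    simp [sq, h30] at hre him
    exfalso
    generalize (x.re : ZMod 3) = a at *
    generalize (x.im : ZMod 3) = b at *
    revert a b
    decide
  · exact hs
  · exact h2.mul hs
  · refine of_associated (m' := ⟨3, -1⟩) (Associated.symm ⟨ε, ?_⟩) ?_
    · ext <;> simp
    · convert of_sub 2 1 using 1
      ext <;> simp
  · have hd := map_dvd (toRing (show (4 : ZMod 7) * 4 = 2 by decide)) hdvd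
    rw [toRing_apply, map_sub, map_pow, toRing_apply _ (ε : ZSqrtTwo), re_ε, im_ε] at hd
    exfalso
    generalize toRing (show (4 : ZMod 7) * 4 = 2 by decide) x = y at hd
    revert y
    decide

end IsUnitMulNorm

lemma isUnitMulNorm_of_dvd (m x : ZSqrtTwo) (hm : m ≠ 0) (h : m ∣ x ^ 2 - (ε : ZSqrtTwo)) :
    IsUnitMulNorm m := by
  induction hk : |QuadraticAlgebra.norm m|.toNat using Nat.strong_induction_on generalizing m x with
  | _ k ih =>
    obtain ⟨z, hmz, hb⟩ := exists_associated_bound m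
    refine .of_associated hmz ?_
    have hz : z ≠ 0 := hmz.ne_zero_iff.mp hm
    have hNz : |QuadraticAlgebra.norm z| = |QuadraticAlgebra.norm m| := by
      obtain ⟨u, rfl⟩ := hmz
      have hu := isUnit_iff_norm.mp u.isUnit
      rw [map_mul, abs_mul, ← Int.natCast_natAbs (QuadraticAlgebra.norm (u : ZSqrtTwo)), hu]
      simp
    replace h := hmz.symm.dvd.trans h
    rcases le_or_gt |QuadraticAlgebra.norm z| 13 with h13 | h13
    · exact .of_norm_le hz hb h13 h
    obtain ⟨q, hq⟩ := exists_norm_sub_le x hz hb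
    obtain ⟨z', hz'⟩ : z ∣ (x - q * z) ^ 2 - (ε : ZSqrtTwo) := by
      have : (x - q * z) ^ 2 - (ε : ZSqrtTwo) = x ^ 2 - ε - z * (q * (2 * x - q * z)) := by ring
      rw [this]
      exact dvd_sub h (dvd_mul_right _ _)
    have hz'0 : z' ≠ 0 := by
      rintro rfl
      rw [mul_zero, sub_eq_zero] at hz'
      have := congrArg QuadraticAlgebra.norm hz'
      rw [map_pow, norm_eq (ε : ZSqrtTwo), re_ε, im_ε] at this
      nlinarith [sq_nonneg (QuadraticAlgebra.norm (x - q * z))]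
    have hlt : |QuadraticAlgebra.norm z'| < |QuadraticAlgebra.norm z| := by
      rw [hz', map_mul, abs_mul] at hq
      nlinarith
    have h1 := ih _ (by omega) z' (x - q * z) hz'0 (hz' ▸ dvd_mul_left _ _) rfl
    refine h1.of_mul hz'0 ?_
    rw [mul_comm, ← hz', sq]
    simpa using IsUnitMulNorm.of_sub (x - q * z) 1

end Descent

section NormsFromSqrtEpsilon

open ZSqrtTwo

/-- The embedding of `ℚ(√2)` into `ℝ` which sends `√2` to `-√2`. -/
noncomputable def realEmbeddingConj : QSqrtTwo →+* ℝ :=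
  liftHom (algebraMap ℚ ℝ) (-Real.sqrt 2) (by simp)

lemma realEmbeddingConj_sqrtTwo :
    realEmbeddingConj (algebraMap ZSqrtTwo QSqrtTwo sqrtTwo) = -Real.sqrt 2 := by
  rw [realEmbeddingConj, liftHom_apply]
  simp [sqrtTwo]

lemma IsNormOf.realEmbeddingConj_nonneg {z : QSqrtTwo}
    (h : IsNormOf (algebraMap ZSqrtTwo QSqrtTwo ε) z) : 0 ≤ realEmbeddingConj z := by
  obtain ⟨x, y, rfl⟩ := h
  rw [algebraMap_ε]
  simp only [map_sub, map_mul, map_add, map_one, realEmbeddingConj_sqrtTwo]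
  have h2 : (1 : ℝ) ≤ Real.sqrt 2 := Real.one_le_sqrt.mpr (by norm_num)
  nlinarith [mul_self_nonneg (realEmbeddingConj x), mul_self_nonneg (realEmbeddingConj y)]

lemma IsUnitMulNorm.isNormOf_natCast {p : ℕ} (hp : p ≠ 0) (h : IsUnitMulNorm (p : ZSqrtTwo)) :
    IsNormOf (algebraMap ZSqrtTwo QSqrtTwo ε) (p : QSqrtTwo) := by
  have key : IsNormOf (algebraMap ZSqrtTwo QSqrtTwo ε) (p : QSqrtTwo) ∨
      IsNormOf (algebraMap ZSqrtTwo QSqrtTwo ε) (-(p : QSqrtTwo)) := by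
    obtain ⟨u, hu⟩ := h
    have hε := IsNormOf.neg_self (algebraMap ZSqrtTwo QSqrtTwo ε)
    have hε0 : -algebraMap ZSqrtTwo QSqrtTwo ε ≠ 0 := by
      rw [neg_ne_zero, Ne, map_eq_zero_iff _ (IsFractionRing.injective ZSqrtTwo QSqrtTwo)]
      exact ε.ne_zero
    obtain ⟨y, hy⟩ := exists_eq_mul_sq u
    have hy0 : algebraMap ZSqrtTwo QSqrtTwo y ≠ 0 := by
      rw [Ne, map_eq_zero_iff _ (IsFractionRing.injective ZSqrtTwo QSqrtTwo)]
      exact y.ne_zero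
    rcases hy with rfl | rfl | rfl | rfl
    · left
      refine IsNormOf.of_mul_sq hy0 ((congrArg _ ?_).mp hu)
      simp [sq]
    · right
      refine IsNormOf.of_mul_sq hy0 ((congrArg _ ?_).mp hu)
      simp [sq]
    · right
      refine IsNormOf.of_mul_sq hy0 (hε.of_mul hε0 ((congrArg _ ?_).mp hu))
      simp [sq]
      ring
    · left
      refine IsNormOf.of_mul_sq hy0 (hε.of_mul hε0 ((congrArg _ ?_).mp hu))
      simp [sq]
      ring
  refine key.resolve_right fun h => ?_
  have := h.realEmbeddingConj_nonneg
  rw [map_neg, map_natCast] at this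
  have hp' : (0 : ℝ) < p := by exact_mod_cast Nat.pos_of_ne_zero hp
  linarith

lemma isNormOf_ε_of_zmod {p : ℕ} [NeZero p] (X Y : ZMod p) (h1 : X * X + 2 * (Y * Y) = 1)
    (h2 : 2 * (X * Y) = 1) : IsNormOf (algebraMap ZSqrtTwo QSqrtTwo ε) (p : QSqrtTwo) := by
  refine (isUnitMulNorm_of_dvd (p : ZSqrtTwo) ⟨X.val, Y.val⟩ ?_ ?_).isNormOf_natCast (NeZero.ne p)
  · exact_mod_cast NeZero.ne p
  · rw [natCast_dvd_iff, ← ZMod.intCast_zmod_eq_zero_iff_dvd, ← ZMod.intCast_zmod_eq_zero_iff_dvd]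
    constructor
    · simp [sq]
      linear_combination h1
    · simp [sq]
      linear_combination h2

lemma isNormOf_ε_of_mod_eight_eq_five {p : ℕ} (hp : p.Prime) (h5 : p % 8 = 5) :
    IsNormOf (algebraMap ZSqrtTwo QSqrtTwo ε) (p : QSqrtTwo) := by
  have hf := Fact.mk hp
  have hp2 : p ≠ 2 := by rintro rfl; omega
  have h2 : (2 : ZMod p) ≠ 0 := by
    intro h
    have : ((2 : ℕ) : ZMod p) = 0 := by exact_mod_cast h
    rw [ZMod.natCast_eq_zero_iff] at this
    exact hp2 ((Nat.prime_dvd_prime_iff_eq hp Nat.prime_two).mp this)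
  obtain ⟨i, hi⟩ := (ZMod.exists_sq_eq_neg_one_iff (p := p)).mpr (by omega)
  have hi0 : 1 + i ≠ 0 := by
    intro h
    apply h2
    linear_combination (-i + 1) * h - hi
  have h2sq : ¬ IsSquare (2 : ZMod p) := by
    rw [ZMod.exists_sq_eq_two_iff hp2]
    omega
  by_cases hsq : IsSquare (2 * (1 + i))
  · obtain ⟨w, hw⟩ := hsq
    have hw0 : w ≠ 0 := by
      rintro rfl
      exact mul_ne_zero h2 hi0 (by rw [hw, mul_zero])
    refine isNormOf_ε_of_zmod ((1 + i) / w) (1 / w) ?_ ?_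
    · field_simp
      linear_combination hw - hi
    · field_simp
      linear_combination hw
  · obtain ⟨w, hw⟩ : IsSquare (1 + i) := by
      rw [← quadraticChar_neg_one_iff_not_isSquare] at h2sq hsq
      rw [map_mul, h2sq, neg_one_mul, neg_inj] at hsq
      exact (quadraticChar_one_iff_isSquare hi0).mp hsq
    have hw0 : w ≠ 0 := by
      rintro rfl
      exact hi0 (by rw [hw, mul_zero])
    refine isNormOf_ε_of_zmod (1 / w) ((1 + i) / (2 * w)) ?_ ?_
    · field_simp
      linear_combination 2 * hw - hi
    · field_simp
      linear_combination hw

lemma isNormOf_ε_of_isSquare {p : ℕ} (hp : p.Prime) (h1 : p % 8 = 1) {s : ZMod p} (hs : s * s = 2)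
    (hsq : IsSquare (1 + s)) :
    IsNormOf (algebraMap ZSqrtTwo QSqrtTwo ε) (p : QSqrtTwo) := by
  have hf := Fact.mk hp
  have hp2 : p ≠ 2 := by rintro rfl; omega
  have h2 : (2 : ZMod p) ≠ 0 := by
    intro h
    have : ((2 : ℕ) : ZMod p) = 0 := by exact_mod_cast h
    rw [ZMod.natCast_eq_zero_iff] at this
    exact hp2 ((Nat.prime_dvd_prime_iff_eq hp Nat.prime_two).mp this)
  have hs0 : s ≠ 0 := by
    rintro rfl
    exact h2 (by rw [← hs, mul_zero])
  obtain ⟨i, hi⟩ := (ZMod.exists_sq_eq_neg_one_iff (p := p)).mpr (by omega)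
  obtain ⟨c, hc⟩ := hsq
  have hc0 : c ≠ 0 := by
    rintro rfl
    apply one_ne_zero (α := ZMod p)
    linear_combination (s - 1) * hc - hs
  obtain ⟨c', hc'⟩ : ∃ c', 1 - s = c' * c' := by
    refine ⟨i / c, ?_⟩
    field_simp
    linear_combination (s - 1) * hc - hs + hi
  refine isNormOf_ε_of_zmod ((c + c') / 2) ((c - c') / (2 * s)) ?_ ?_
  · field_simp
    rw [pow_two s, hs]
    linear_combination (-4) * hc - 4 * hc'
  · field_simp
    linear_combination -hc + hc'

lemma isNormUnit_ε (n : ℕ) [NeZero n]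
    (h : ∀ p : ℕ, p.Prime → p ∣ n → IsNormOf (algebraMap ZSqrtTwo QSqrtTwo ε) (p : QSqrtTwo)) :
    IsNormUnit n ε := by
  refine isNormUnit_of_isNormOf n ?_
  rw [algebraMap_radicand]
  refine IsNormOf.mul ?_ (IsNormOf.natCast (NeZero.ne n) h)
  have hs : IsNormOf (algebraMap ZSqrtTwo QSqrtTwo ε) (-algebraMap ZSqrtTwo QSqrtTwo sqrtTwo) :=
    ⟨1, 1, by rw [algebraMap_ε]; ring⟩
  have := hs.mul (IsNormOf.neg_self _)
  rwa [neg_mul_neg, ← map_mul] at this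

end NormsFromSqrtEpsilon

section Obstruction

open ZSqrtTwo

lemma exists_of_isNormUnit (n : ℕ) [NeZero n] (hd : Squarefree (radicand n)) {u : ZSqrtTwoˣ}
    (h : IsNormUnit n u) : ∃ x y m : ZSqrtTwo, x * x - radicand n * (y * y) = u * m ^ 2 ∧
      IsCoprime x m := by
  obtain ⟨z, hz⟩ := h
  obtain ⟨α, m, -, hcop, hα, -⟩ := exists_isCoprime_norm_eq (R := ZSqrtTwo) (k := QSqrtTwo)
    (d := radicand n) (x := z) (u := u) (s := 1) (by rw [hz, one_pow, mul_one])
  have hα' : α.re * α.re - radicand n * (α.im * α.im) = u * m ^ 2 := by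
    rw [← hα, norm_def]
    ring
  refine ⟨α.re, α.im, m, hα', isCoprime_of_prime_dvd ?_ fun p hp hpx hpm => ?_⟩
  · rintro ⟨hx, rfl⟩
    rw [hx] at hα' hcop
    have h0 : radicand n * (α.im * α.im) = 0 := by linear_combination -hα'
    rw [isCoprime_zero_left] at hcop
    exact mul_ne_zero hd.ne_zero (mul_ne_zero hcop.ne_zero hcop.ne_zero) h0
  · refine isCoprime_of_norm_eq (d := radicand n) (fun q hq h2 => ?_)
      (fun q hq h => hq.not_isUnit (hd q h)) hcop hα hp hpm (hpx.mul_left 2)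
    rw [← sqrtTwo_mul_self] at h2
    refine ((hq.dvd_or_dvd h2).elim id id).trans ⟨n * (ε : ZSqrtTwo), ?_⟩
    ext <;> simp [sqrtTwo]

lemma map_radicand_eq_zero {S : Type*} [CommRing S] (f : ZSqrtTwo →+* S) {n : ℕ}
    (hn : (n : S) = 0) : f (radicand n) = 0 := by
  have : radicand n = n * ⟨2, 1⟩ := by ext <;> simp [mul_comm]
  rw [this, map_mul, map_natCast, hn, zero_mul]

lemma IsNormUnit.isSquare {n : ℕ} [NeZero n] (hd : Squarefree (radicand n)) {u : ZSqrtTwoˣ}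
    (h : IsNormUnit n u) {F : Type*} [Field F] (f : ZSqrtTwo →+* F) (hn : (n : F) = 0) :
    IsSquare (f u) := by
  obtain ⟨x, y, m, hxy, a, b, hab⟩ := exists_of_isNormUnit n hd h
  have h1 := congrArg f hxy
  simp only [map_sub, map_mul, map_pow, map_radicand_eq_zero f hn, zero_mul, sub_zero] at h1
  have hm : f m ≠ 0 := by
    intro hm
    have hx : f x = 0 := by
      rw [hm] at h1
      simpa using h1
    have := congrArg f hab
    simp [hm, hx] at this
  refine ⟨f x / f m, ?_⟩
  field_simp
  linear_combination -h1

lemma not_isNormUnit_neg_one {n : ℕ} [NeZero n] (hd : Squarefree (radicand n)) {p : ℕ}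
    (hp : p.Prime) (hpn : p ∣ n) (h7 : p % 8 = 7) : ¬ IsNormUnit n (-1) := by
  intro h
  have hf := Fact.mk hp
  obtain ⟨s, hs⟩ := (ZMod.exists_sq_eq_two_iff (p := p) (by rintro rfl; omega)).mpr (Or.inr h7)
  have := h.isSquare hd (toRing hs.symm) ((ZMod.natCast_eq_zero_iff _ _).mpr hpn)
  rw [Units.val_neg, Units.val_one, map_neg, map_one, ZMod.exists_sq_eq_neg_one_iff] at this
  omega

lemma not_isNormUnit_of_norm_eq_neg_one {n : ℕ} [NeZero n] (hd : Squarefree (radicand n)) {p : ℕ}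
    (hp : p.Prime) (hpn : p ∣ n) (h7 : p % 8 = 7) {u : ZSqrtTwoˣ}
    (hu : QuadraticAlgebra.norm (u : ZSqrtTwo) = -1) : ¬ IsNormUnit n u := by
  intro h
  have hf := Fact.mk hp
  obtain ⟨s, hs⟩ := (ZMod.exists_sq_eq_two_iff (p := p) (by rintro rfl; omega)).mpr (Or.inr h7)
  have hn : (n : ZMod p) = 0 := (ZMod.natCast_eq_zero_iff _ _).mpr hpn
  have h1 := (h.isSquare hd (toRing hs.symm) hn).mul
    (h.isSquare hd (toRing (s := -s) (by rw [neg_mul_neg, hs])) hn)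
  have h2 : toRing hs.symm (u : ZSqrtTwo) * toRing (s := -s) (by rw [neg_mul_neg, hs])
      (u : ZSqrtTwo) = -1 := by
    have := congrArg (Int.cast : ℤ → ZMod p) hu
    rw [norm_eq] at this
    push_cast at this
    rw [toRing_apply, toRing_apply]
    linear_combination this + (u.val.im : ZMod p) * u.val.im * hs
  rw [h2, ZMod.exists_sq_eq_neg_one_iff] at h1
  omega

lemma not_isNormUnit_ε_of_mod_eight_eq_three {n : ℕ} [NeZero n] (hd : Squarefree (radicand n))
    {p : ℕ} (hp : p.Prime) (hpn : p ∣ n) (h3 : p % 8 = 3) : ¬ IsNormUnit n ε := by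
  intro h
  have hf := Fact.mk hp
  have hprime := prime_natCast hp (Or.inl h3)
  obtain ⟨x, y, m, hxy, hcop⟩ := exists_of_isNormUnit n hd h
  have hdvd : (p : ZSqrtTwo) ∣ x * x - ε * m ^ 2 := by
    have : x * x - ε * m ^ 2 = radicand n * (y * y) := by linear_combination hxy
    rw [this]
    refine Dvd.dvd.mul_right ?_ _
    have : radicand n = n * ⟨2, 1⟩ := by ext <;> simp [mul_comm]
    rw [this]
    exact (Nat.cast_dvd_cast hpn).mul_right _
  obtain ⟨hre, him⟩ := natCast_dvd_iff.mp hdvd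
  rw [← ZMod.intCast_zmod_eq_zero_iff_dvd] at hre him
  simp [sq] at hre him
  have hN : ((QuadraticAlgebra.norm x : ℤ) : ZMod p) ^ 2 =
      -((QuadraticAlgebra.norm m : ℤ) : ZMod p) ^ 2 := by
    rw [norm_eq, norm_eq]
    push_cast
    linear_combination
      (x.re * x.re + 2 * x.im * x.im + (m.re * m.re + 2 * m.im * m.im +
        2 * (m.re * m.im + m.im * m.re)) : ZMod p) * hre -
      2 * (x.re * x.im + x.im * x.re + (m.re * m.im + m.im * m.re +
        (m.re * m.re + 2 * m.im * m.im)) : ZMod p) * him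
  have hNm : ((QuadraticAlgebra.norm m : ℤ) : ZMod p) = 0 := by
    by_contra hne
    have : IsSquare (-1 : ZMod p) := by
      refine ⟨((QuadraticAlgebra.norm x : ℤ) : ZMod p) / (QuadraticAlgebra.norm m : ℤ), ?_⟩
      field_simp
      linear_combination -hN
    rw [ZMod.exists_sq_eq_neg_one_iff] at this
    omega
  have key : ∀ z : ZSqrtTwo, ((QuadraticAlgebra.norm z : ℤ) : ZMod p) = 0 → (p : ZSqrtTwo) ∣ z := by
    intro z hz
    rw [ZMod.intCast_zmod_eq_zero_iff_dvd] at hz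
    have h1 : (p : ZSqrtTwo) ∣ z * star z := by
      rw [← algebraMap_norm_eq_mul_star]
      obtain ⟨c, hc⟩ := hz
      exact ⟨c, by rw [hc]; simp⟩
    rcases hprime.dvd_or_dvd h1 with h1 | h1
    · exact h1
    · rw [natCast_dvd_iff] at h1 ⊢
      simpa using h1
  have hNx : ((QuadraticAlgebra.norm x : ℤ) : ZMod p) = 0 := by
    rw [hNm] at hN
    simpa using hN
  exact hprime.not_isUnit (hcop.isUnit_of_dvd' (key x hNx) (key m hNm))

end Obstruction

section Quartic

lemma isSquare_one_add_iff {p : ℕ} (hp : p.Prime) (h1 : p % 8 = 1) {s : ZMod p} (hs : s * s = 2) :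
    IsSquare (1 + s) ↔ quartSym p 2 = (-1) ^ ((p - 1) / 8) := by
  have hf := Fact.mk hp
  obtain ⟨k, hpk⟩ : ∃ k, p = 8 * k + 1 := ⟨p / 8, by omega⟩
  have e1 : (p - 1) / 8 = k := by omega
  have e2 : (p - 1) / 4 = 2 * k := by omega
  have e3 : p / 2 = 4 * k := by omega
  have hp2 : p ≠ 2 := by omega
  have h2 : (2 : ZMod p) ≠ 0 := by
    intro h
    have : ((2 : ℕ) : ZMod p) = 0 := by exact_mod_cast h
    rw [ZMod.natCast_eq_zero_iff] at this
    exact hp2 ((Nat.prime_dvd_prime_iff_eq hp Nat.prime_two).mp this)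
  have hneg : (-1 : ZMod p) ≠ 1 := by
    intro h
    apply h2
    linear_combination -h
  obtain ⟨i, hi⟩ := (ZMod.exists_sq_eq_neg_one_iff (p := p)).mpr (by omega)
  have hi0 : 1 + i ≠ 0 := by
    intro h
    apply h2
    linear_combination (-i + 1) * h - hi
  have hs0 : 1 + s ≠ 0 := by
    intro h
    apply one_ne_zero (α := ZMod p)
    linear_combination (s - 1) * h - hs
  have hz : (1 + i) * (1 + s) = (1 + s * (1 + i) / 2) * (1 + s * (1 + i) / 2) := by
    field_simp
    linear_combination (-(1 + i) ^ 2) * hs + 2 * hi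
  have hsq : IsSquare (1 + s) ↔ IsSquare (1 + i) := by
    constructor
    · intro h
      have := (IsSquare.mul_self (1 + s * (1 + i) / 2)).div h
      rwa [← hz, mul_div_cancel_right₀ _ hs0] at this
    · intro h
      have := (IsSquare.mul_self (1 + s * (1 + i) / 2)).div h
      rwa [← hz, mul_div_cancel_left₀ _ hi0] at this
  have hpow : (1 + i) ^ (4 * k) = 2 ^ (2 * k) * (-1) ^ k := by
    have : (1 + i) ^ 4 = 2 ^ 2 * (-1) := by linear_combination (-(i * i + 4 * i + 5)) * hi
    rw [pow_mul, this, mul_pow, pow_mul]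
  have h2k : (2 : ZMod p) ^ (2 * k) = 1 ∨ (2 : ZMod p) ^ (2 * k) = -1 := by
    rw [← sq_eq_one_iff, ← pow_mul, show 2 * k * 2 = p / 2 by omega]
    exact (ZMod.euler_criterion p h2).mp ⟨s, hs.symm⟩
  rw [hsq, ZMod.euler_criterion p hi0, e3, hpow, quartSym, e1, e2]
  rcases neg_one_pow_eq_or ℤ k with hk | hk <;> rw [hk]
  · have hk' : (-1 : ZMod p) ^ k = 1 := by exact_mod_cast congrArg (Int.cast : ℤ → ZMod p) hk
    rcases h2k with h | h <;> simp [h, hk', hneg]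
  · have hk' : (-1 : ZMod p) ^ k = -1 := by exact_mod_cast congrArg (Int.cast : ℤ → ZMod p) hk
    rcases h2k with h | h <;> simp [h, hk', hneg]

lemma legSym_two {p : ℕ} (hp : p.Prime) (h2 : p % 2 = 1) :
    legSym p 2 = if p % 8 = 1 ∨ p % 8 = 7 then 1 else -1 := by
  have hf := Fact.mk hp
  have hp2 : p ≠ 2 := by omega
  have h20 : (2 : ZMod p) ≠ 0 := by
    intro h
    have : ((2 : ℕ) : ZMod p) = 0 := by exact_mod_cast h
    rw [ZMod.natCast_eq_zero_iff] at this
    exact hp2 ((Nat.prime_dvd_prime_iff_eq hp Nat.prime_two).mp this)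
  have h3 : (p - 1) / 2 = p / 2 := by omega
  split_ifs with h <;> rw [← ZMod.exists_sq_eq_two_iff hp2, ZMod.euler_criterion p h20] at h <;>
    simp [legSym, h20, h3, h]

end Quartic

section Cyclic

open ZSqrtTwo

section NormIndex

variable {n : ℕ} [NeZero n]

lemma normIndex_eq_one_of_mod_eight_eq_seven (hd : Squarefree (radicand n)) {p : ℕ}
    (hp : p.Prime) (hpn : p ∣ n) (h7 : p % 8 = 7) : normIndex n = 1 :=
  normIndex_eq_one n (not_isNormUnit_neg_one hd hp hpn h7)
    (not_isNormUnit_of_norm_eq_neg_one hd hp hpn h7 (by rw [norm_eq]; simp))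
    (not_isNormUnit_of_norm_eq_neg_one hd hp hpn h7 (by rw [norm_eq]; simp))

lemma normIndex_ne_one_of_forall (hn : Odd n) (h : ∀ p : ℕ, p.Prime → p ∣ n → p % 8 ≠ 7) :
    normIndex n ≠ 1 :=
  normIndex_ne_one n (isNormUnit_neg_one n hn h)

lemma normIndex_eq_four_of_forall (hn : Odd n)
    (h : ∀ p : ℕ, p.Prime → p ∣ n → p % 8 = 5) : normIndex n = 4 :=
  normIndex_eq_four n (isNormUnit_neg_one n hn fun p hp hpn => by rw [h p hp hpn]; decide)
    (isNormUnit_ε n fun p hp hpn => isNormOf_ε_of_mod_eight_eq_five hp (h p hp hpn))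

lemma normIndex_prime_eq_two_iff {p : ℕ} (hp : p.Prime) [NeZero p] (hd : Squarefree (radicand p))
    (h1 : p % 8 = 1) : normIndex p = 2 ↔ quartSym p 2 ≠ (-1) ^ ((p - 1) / 8) := by
  have hf := Fact.mk hp
  obtain ⟨s, hs⟩ := (ZMod.exists_sq_eq_two_iff (p := p) (by rintro rfl; omega)).mpr (Or.inl h1)
  have hodd : Odd p := Nat.odd_iff.mpr (by omega)
  have heq : ∀ q : ℕ, q.Prime → q ∣ p → q = p := fun q hq h =>
    (Nat.prime_dvd_prime_iff_eq hq hp).mp h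
  have h7 : ∀ q : ℕ, q.Prime → q ∣ p → q % 8 ≠ 7 := fun q hq h => by
    rw [heq q hq h]; omega
  rw [ne_eq, ← isSquare_one_add_iff hp h1 hs.symm]
  constructor
  · intro h hsq
    have := normIndex_eq_four p (isNormUnit_neg_one p hodd h7) (isNormUnit_ε p fun q hq h => by
      rw [heq q hq h]
      exact isNormOf_ε_of_isSquare hp h1 hs.symm hsq)
    omega
  · intro hsq
    have h4 := normIndex_ne_four p fun h => hsq (by
      have := h.isSquare hd (toRing hs.symm) (by simp)
      rw [toRing_apply] at this
      simpa using this)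
    have h5 := normIndex_ne_one_of_forall hodd h7
    have := normIndex_mem p
    tauto

end NormIndex

lemma four_mul_twoTorsCard {n : ℕ} [NeZero n] (hn : Odd n) (hsq : Squarefree n)
    {K : IntermediateField ℚ ℝ} (hK : K = IntermediateField.adjoin ℚ
      ({Real.sqrt ((n : ℝ) * ((1 : ℝ) + Real.sqrt 2) * Real.sqrt 2)} : Set ℝ)) :
    4 * twoTorsCard K = 2 ^ (∑ p ∈ n.primeFactors, numPrimesAbove p) * normIndex n := by
  obtain ⟨s, hs, hcard⟩ := exists_isPrimeFactorization_radicand n hn hsq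
  have h := eight_mul_twoTorsCard n hs.squarefree hK s (fun p hp => ⟨hs.prime p hp, hs.dvd hp⟩)
    hs.eq_of_dvd (fun p => hs.exists_associated)
  rw [hcard, pow_succ, ← normIndex] at h
  linarith

lemma sum_numPrimesAbove_prime {p : ℕ} (hp : p.Prime) :
    ∑ r ∈ p.primeFactors, numPrimesAbove r = numPrimesAbove p := by
  rw [hp.primeFactors, Finset.sum_singleton]

lemma sum_numPrimesAbove_mul {p q : ℕ} (hp : p.Prime) (hq : q.Prime) (hpq : p ≠ q) :
    ∑ r ∈ (p * q).primeFactors, numPrimesAbove r = numPrimesAbove p + numPrimesAbove q := by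
  rw [Nat.primeFactors_mul hp.ne_zero hq.ne_zero, hp.primeFactors, hq.primeFactors,
    ← Finset.insert_eq, Finset.sum_pair hpq]

lemma numPrimesAbove_pos (p : ℕ) : 1 ≤ numPrimesAbove p := by
  unfold numPrimesAbove; split_ifs <;> omega

lemma card_primeFactors_le_sum (n : ℕ) :
    n.primeFactors.card ≤ ∑ p ∈ n.primeFactors, numPrimesAbove p := by
  simpa using Finset.card_nsmul_le_sum n.primeFactors numPrimesAbove 1
    fun p _ => numPrimesAbove_pos p

lemma card_primeFactors_lt_sum {n p : ℕ} (hp : p ∈ n.primeFactors) (h7 : p % 8 = 7) :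
    n.primeFactors.card < ∑ p ∈ n.primeFactors, numPrimesAbove p := by
  rw [Finset.card_eq_sum_ones]
  exact Finset.sum_lt_sum (fun p _ => numPrimesAbove_pos p)
    ⟨p, hp, by simp [numPrimesAbove, h7]⟩

lemma prime_or_mul_of_card_primeFactors_le_two {n : ℕ} (hsq : Squarefree n)
    (h : n.primeFactors.card ≤ 2) : n = 1 ∨ n.Prime ∨
      ∃ p q : ℕ, p.Prime ∧ q.Prime ∧ p ≠ q ∧ n = p * q := by
  have hprod := Nat.prod_primeFactors_of_squarefree hsq
  have hprime : ∀ p ∈ n.primeFactors, p.Prime := fun p => Nat.prime_of_mem_primeFactors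
  interval_cases hc : n.primeFactors.card
  · rw [Finset.card_eq_zero.mp hc] at hprod
    exact Or.inl (by simpa using hprod.symm)
  · obtain ⟨p, hp⟩ := Finset.card_eq_one.mp hc
    rw [hp, Finset.prod_singleton] at hprod
    exact Or.inr (Or.inl (hprod ▸ hprime p (by simp [hp])))
  · obtain ⟨p, q, hpq, h⟩ := Finset.card_eq_two.mp hc
    rw [h, Finset.prod_pair hpq] at hprod
    exact Or.inr (Or.inr ⟨p, q, hprime p (by simp [h]), hprime q (by simp [h]), hpq, hprod.symm⟩)

lemma card_primeFactors_le_two {n : ℕ} [NeZero n] (hn : Odd n)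
    (h : 2 ^ (∑ p ∈ n.primeFactors, numPrimesAbove p) * normIndex n = 8) :
    n.primeFactors.card ≤ 2 := by
  by_contra! hc
  have h3 := hc.trans_le (card_primeFactors_le_sum n)
  by_cases h7 : ∃ p ∈ n.primeFactors, p % 8 = 7
  · obtain ⟨p, hp, h7⟩ := h7
    have h4 := card_primeFactors_lt_sum hp h7
    have h5 : 2 ^ 4 ∣ 8 := (pow_dvd_pow 2 (by omega)).trans (Dvd.intro _ h)
    omega
  · have h1 := normIndex_ne_one_of_forall hn fun p hp hpn h =>
      h7 ⟨p, Nat.mem_primeFactors.mpr ⟨hp, hpn, NeZero.ne n⟩, h⟩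
    have h5 : 2 ^ 3 ≤ 2 ^ ∑ p ∈ n.primeFactors, numPrimesAbove p :=
      Nat.pow_le_pow_right (by norm_num) (by omega)
    rcases normIndex_mem n with h' | h' | h'
    · exact h1 h'
    · rw [h'] at h
      omega
    · rw [h'] at h
      omega

lemma two_pow_mul_normIndex_prime {p : ℕ} (hp : p.Prime) [NeZero p] (hd : Squarefree (radicand p))
    (h2 : p % 2 = 1) :
    2 ^ (∑ r ∈ p.primeFactors, numPrimesAbove r) * normIndex p = 8 ↔
      p % 8 = 5 ∨ p % 8 = 1 ∧ quartSym p 2 ≠ (-1) ^ ((p - 1) / 8) := by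
  rw [sum_numPrimesAbove_prime hp]
  have h8 : p % 8 = 1 ∨ p % 8 = 3 ∨ p % 8 = 5 ∨ p % 8 = 7 := by omega
  rcases h8 with h | h | h | h
  · have := normIndex_prime_eq_two_iff hp hd h
    simp only [h, numPrimesAbove, true_or, if_true, true_and, ← this]
    omega
  · have := normIndex_ne_four p (not_isNormUnit_ε_of_mod_eight_eq_three hd hp dvd_rfl h)
    simp [h, numPrimesAbove]
    omega
  · have := normIndex_eq_four_of_forall (n := p) (Nat.odd_iff.mpr h2) fun q hq hqp => by
      rwa [(Nat.prime_dvd_prime_iff_eq hq hp).mp hqp]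
    simp [h, numPrimesAbove, this]
  · have := normIndex_eq_one_of_mod_eight_eq_seven hd hp dvd_rfl h
    simp [h, numPrimesAbove, this]

lemma two_pow_mul_normIndex_mul {p q : ℕ} (hp : p.Prime) (hq : q.Prime) (hpq : p ≠ q)
    [NeZero (p * q)] (hd : Squarefree (radicand (p * q))) (hn : Odd (p * q)) :
    2 ^ (∑ r ∈ (p * q).primeFactors, numPrimesAbove r) * normIndex (p * q) = 8 ↔
      (p % 8 = 3 ∨ p % 8 = 5) ∧ q % 4 = 3 ∨ (q % 8 = 3 ∨ q % 8 = 5) ∧ p % 4 = 3 := by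
  rw [sum_numPrimesAbove_mul hp hq hpq]
  obtain ⟨hp2, hq2⟩ := Nat.odd_mul.mp hn
  rw [Nat.odd_iff] at hp2 hq2
  have hdvd : ∀ r : ℕ, r.Prime → r ∣ p * q → r = p ∨ r = q := fun r hr h =>
    (hr.dvd_mul.mp h).imp (Nat.prime_dvd_prime_iff_eq hr hp).mp
      (Nat.prime_dvd_prime_iff_eq hr hq).mp
  have hmem := normIndex_mem (p * q)
  have hp7 := normIndex_eq_one_of_mod_eight_eq_seven hd hp (dvd_mul_right p q)
  have hq7 := normIndex_eq_one_of_mod_eight_eq_seven hd hq (dvd_mul_left q p)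
  have hp3 := fun h => normIndex_ne_four _
    (not_isNormUnit_ε_of_mod_eight_eq_three hd hp (dvd_mul_right p q) h)
  have hq3 := fun h => normIndex_ne_four _
    (not_isNormUnit_ε_of_mod_eight_eq_three hd hq (dvd_mul_left q p) h)
  have h1 : p % 8 ≠ 7 → q % 8 ≠ 7 → normIndex (p * q) ≠ 1 := fun h h' =>
    normIndex_ne_one_of_forall hn fun r hr hrn => by
      rcases hdvd r hr hrn with rfl | rfl <;> assumption
  have h4 : p % 8 = 5 → q % 8 = 5 → normIndex (p * q) = 4 := fun h h' =>
    normIndex_eq_four_of_forall hn fun r hr hrn => by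
      rcases hdvd r hr hrn with rfl | rfl <;> assumption
  have hp8 : p % 8 = 1 ∨ p % 8 = 3 ∨ p % 8 = 5 ∨ p % 8 = 7 := by omega
  have hq8 : q % 8 = 1 ∨ q % 8 = 3 ∨ q % 8 = 5 ∨ q % 8 = 7 := by omega
  generalize normIndex (p * q) = i at *
  have hq4 : q % 4 = q % 8 % 4 := by omega
  have hp4 : p % 4 = p % 8 % 4 := by omega
  rw [hp4, hq4]
  unfold numPrimesAbove
  rcases hp8 with hp8 | hp8 | hp8 | hp8 <;> rcases hq8 with hq8 | hq8 | hq8 | hq8 <;>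
    simp [hp8, hq8] at * <;> omega

lemma twoTorsCard_eq_two_iff (n : ℕ) (hnodd : Odd n) (hnsq : Squarefree n)
    (K : IntermediateField ℚ ℝ) (hK : K = IntermediateField.adjoin ℚ
      ({Real.sqrt ((n : ℝ) * ((1 : ℝ) + Real.sqrt 2) * Real.sqrt 2)} : Set ℝ)) :
    twoTorsCard K = 2 ↔
      ((∃ p : ℕ, p.Prime ∧ p % 4 = 1 ∧ n = p ∧
          (legSym p 2 = -1 ∨ (legSym p 2 = 1 ∧
            quartSym p 2 ≠ (-1 : ℤ) ^ ((p - 1) / 8)))) ∨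
        (∃ q₁ q₂ : ℕ, q₁.Prime ∧ q₂.Prime ∧ q₁ % 4 = 3 ∧ q₂ % 4 = 3 ∧ q₁ ≠ q₂ ∧
          n = q₁ * q₂ ∧ (legSym q₁ 2 = -1 ∨ legSym q₂ 2 = -1)) ∨
        (∃ p q : ℕ, p.Prime ∧ p % 4 = 1 ∧ q.Prime ∧ q % 4 = 3 ∧ n = p * q ∧
          legSym p 2 = -1)) := by
  have : NeZero n := ⟨hnsq.ne_zero⟩
  have hd : Squarefree (radicand n) := by
    obtain ⟨s, hs, -⟩ := exists_isPrimeFactorization_radicand n hnodd hnsq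
    exact hs.squarefree
  have h4 := four_mul_twoTorsCard hnodd hnsq hK
  have hleg : ∀ {p : ℕ}, p.Prime → p % 2 = 1 → (legSym p 2 = -1 ↔ p % 8 = 3 ∨ p % 8 = 5) := by
    intro p hp h2
    rw [legSym_two hp h2]
    split_ifs <;> simp <;> omega
  have hleg' : ∀ {p : ℕ}, p.Prime → p % 2 = 1 → (legSym p 2 = 1 ↔ p % 8 = 1 ∨ p % 8 = 7) := by
    intro p hp h2
    rw [legSym_two hp h2]
    split_ifs <;> simp <;> omega
  trans 2 ^ (∑ p ∈ n.primeFactors, numPrimesAbove p) * normIndex n = 8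
  · omega
  constructor
  · intro h
    rcases prime_or_mul_of_card_primeFactors_le_two hnsq (card_primeFactors_le_two hnodd h) with
      rfl | hp | ⟨p, q, hp, hq, hpq, rfl⟩
    · have := normIndex_mem 1
      simp at h
      omega
    · have h2 := Nat.odd_iff.mp hnodd
      rw [two_pow_mul_normIndex_prime hp hd h2] at h
      refine Or.inl ⟨n, hp, by omega, rfl, ?_⟩
      rw [hleg hp h2, hleg' hp h2]
      tauto
    · obtain ⟨hp2, hq2⟩ := Nat.odd_mul.mp hnodd
      rw [Nat.odd_iff] at hp2 hq2
      rw [two_pow_mul_normIndex_mul hp hq hpq hd hnodd] at h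
      rcases (by omega : p % 4 = 1 ∨ p % 4 = 3) with hp4 | hp4
      · refine Or.inr (Or.inr ⟨p, q, hp, hp4, hq, by omega, rfl, ?_⟩)
        rw [hleg hp hp2]
        omega
      · rcases (by omega : q % 4 = 1 ∨ q % 4 = 3) with hq4 | hq4
        · refine Or.inr (Or.inr ⟨q, p, hq, hq4, hp, hp4, mul_comm p q, ?_⟩)
          rw [hleg hq hq2]
          omega
        · refine Or.inr (Or.inl ⟨p, q, hp, hq, hp4, hq4, hpq, rfl, ?_⟩)
          rw [hleg hp hp2, hleg hq hq2]
          omega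
  · rintro (⟨p, hp, hp4, rfl, h⟩ | ⟨p, q, hp, hq, hp4, hq4, hpq, rfl, h⟩ |
      ⟨p, q, hp, hp4, hq, hq4, rfl, h⟩)
    · rw [hleg hp (by omega), hleg' hp (by omega)] at h
      rw [two_pow_mul_normIndex_prime hp hd (by omega)]
      exact h.imp (by omega) (And.imp_left (by omega))
    · rw [hleg hp (by omega), hleg hq (by omega)] at h
      rw [two_pow_mul_normIndex_mul hp hq hpq hd hnodd]
      omega
    · rw [hleg hp (by omega)] at h
      rw [two_pow_mul_normIndex_mul hp hq (by rintro rfl; omega) hd hnodd]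
      omega

end Cyclic

end TwoTorsion

/-- `n` odd squarefree positive, `𝕂 = ℚ(√(n·(1+√2)·√2))`.
The 2-class group `H` is nontrivial cyclic (`r₂(H) = 1`, i.e. the 2-torsion of
the class group has exactly 2 elements) iff `n` has one of the listed forms
(`p` a prime `≡ 1 (mod 4)`, `q, q₁, q₂` distinct primes `≡ 3 (mod 4)`). -/
theorem stmt_17
    (n : ℕ) (hnodd : Odd n) (hnsq : Squarefree n) (hn0 : 0 < n)
    (K : IntermediateField ℚ ℝ)
    (hK : K = IntermediateField.adjoin ℚ
      ({Real.sqrt ((n : ℝ) * ((1 : ℝ) + Real.sqrt 2) * Real.sqrt 2)} : Set ℝ))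
    [NumberField K] :
    twoTorsCard K = 2 ^ 1 ↔
      ((∃ p : ℕ, p.Prime ∧ p % 4 = 1 ∧ n = p ∧
          (legSym p 2 = -1 ∨ (legSym p 2 = 1 ∧
            quartSym p 2 ≠ (-1 : ℤ) ^ ((p - 1) / 8)))) ∨
        (∃ q₁ q₂ : ℕ, q₁.Prime ∧ q₂.Prime ∧ q₁ % 4 = 3 ∧ q₂ % 4 = 3 ∧ q₁ ≠ q₂ ∧
          n = q₁ * q₂ ∧ (legSym q₁ 2 = -1 ∨ legSym q₂ 2 = -1)) ∨
        (∃ p q : ℕ, p.Prime ∧ p % 4 = 1 ∧ q.Prime ∧ q % 4 = 3 ∧ n = p * q ∧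
          legSym p 2 = -1)) := by
  rw [pow_one]
  exact twoTorsCard_eq_two_iff n hnodd hnsq K hK
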